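/- arXiv:math/0208254 — 6 statements merged into one kernel-verified Lean document; each statement's English description precedes it below -/
import Mathlib

section
/- For every complex matrix F of size m × n there exists a unique complex matrix G of size n × m satisfying the four Penrose equations: G·F·G = G, F·G·F = F, (F·G)ᴴ = F·G, and (G·F)ᴴ = G·F. (This unique G is the Moore–Penrose inverse of F.) -/
open Matrix

/-- A Hermitian matrix has a Hermitian commuting generalized inverse. -/
lemma hermitian_ginv {n : ℕ} (A : Matrix (Fin n) (Fin n) ℂ) (hA : A.IsHermitian) :
    ∃ B : Matrix (Fin n) (Fin n) ℂ, Bᴴ = B ∧ A * B = B * A ∧ A * B * A = A ∧ B * A * B = B := by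
  obtain ⟨U, d, hU, hd⟩ : ∃ (U : Matrix (Fin n) (Fin n) ℂ) (d : Fin n → ℝ), Uᴴ * U = 1 ∧
      A = U * diagonal (fun i => (d i : ℂ)) * Uᴴ := by
    refine ⟨hA.eigenvectorUnitary, hA.eigenvalues, ?_, ?_⟩
    · exact Unitary.coe_star_mul_self hA.eigenvectorUnitary
    · have h := hA.spectral_theorem
      rw [Unitary.conjStarAlgAut_apply] at h
      exact h
  have key : ∀ X Y : Matrix (Fin n) (Fin n) ℂ, (U * X * Uᴴ) * (U * Y * Uᴴ) = U * (X * Y) * Uᴴ := by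
    intro X Y
    calc (U * X * Uᴴ) * (U * Y * Uᴴ) = U * X * (Uᴴ * U) * Y * Uᴴ := by
          simp only [Matrix.mul_assoc]
      _ = _ := by rw [hU]; simp only [Matrix.mul_assoc, Matrix.one_mul]
  refine ⟨U * diagonal (fun i => ((d i)⁻¹ : ℂ)) * Uᴴ, ?_, ?_, ?_, ?_⟩
  · rw [conjTranspose_mul, conjTranspose_mul, conjTranspose_conjTranspose,
      diagonal_conjTranspose, Matrix.mul_assoc]
    congr 3
    ext i
    simp
  · rw [hd, key, key, diagonal_mul_diagonal, diagonal_mul_diagonal]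
    simp only [mul_comm]
  · rw [hd, key, key, diagonal_mul_diagonal, diagonal_mul_diagonal]
    simp only [mul_inv_mul_cancel]
  · rw [hd, key, key, diagonal_mul_diagonal, diagonal_mul_diagonal]
    congr 3
    ext i
    by_cases h : (d i : ℂ) = 0
    · simp [h]
    · field_simp

section
open scoped ComplexOrder

lemma gram_cancel {m n : ℕ} (F : Matrix (Fin m) (Fin n) ℂ) (X : Matrix (Fin n) (Fin n) ℂ)
    (h : Fᴴ * F * X = 0) : F * X = 0 :=
  (conjTranspose_mul_self_mul_eq_zero F X).1 h

end

/-- **Moore–Penrose inverse.** For every complex `m × n` matrix `F` there exists a unique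
complex `n × m` matrix `G` satisfying the four Penrose equations. -/
theorem moore_penrose_exists_unique (m n : ℕ) (F : Matrix (Fin m) (Fin n) ℂ) :
    ∃! G : Matrix (Fin n) (Fin m) ℂ,
      G * F * G = G ∧ F * G * F = F ∧ (F * G)ᴴ = F * G ∧ (G * F)ᴴ = G * F := by
  apply existsUnique_of_exists_of_unique
  · obtain ⟨B, hB, hc, h1, h2⟩ := hermitian_ginv (Fᴴ * F) (isHermitian_conjTranspose_mul_self F)
    refine ⟨B * Fᴴ, ?_, ?_, ?_, ?_⟩
    · calc B * Fᴴ * F * (B * Fᴴ) = (B * (Fᴴ * F) * B) * Fᴴ := by simp only [Matrix.mul_assoc]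
        _ = _ := by rw [h2]
    · have h : (Fᴴ * F) * (B * (Fᴴ * F) - 1) = 0 := by
        rw [Matrix.mul_sub, ← Matrix.mul_assoc, h1, Matrix.mul_one, sub_self]
      replace h := gram_cancel _ _ h
      rw [Matrix.mul_sub, Matrix.mul_one, sub_eq_zero] at h
      simpa only [Matrix.mul_assoc] using h
    · simp only [conjTranspose_mul, conjTranspose_conjTranspose, hB, Matrix.mul_assoc]
    · rw [Matrix.mul_assoc, ← hc]
      simp only [conjTranspose_mul, conjTranspose_conjTranspose, hB]
      exact hc.symm
  · rintro G H ⟨g1, g2, g3, g4⟩ ⟨h1, h2, h3, h4⟩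
    have e1 : G * F = H * F := by
      have h : G * F = (G * F) * (H * F) := by
        rw [Matrix.mul_assoc G, ← Matrix.mul_assoc F, h2]
      have h' := congrArg conjTranspose h
      rw [conjTranspose_mul (G * F), g4, h4, Matrix.mul_assoc H, ← Matrix.mul_assoc F, g2] at h'
      exact h'
    have e2 : F * G = F * H := by
      have h : F * G = (F * H) * (F * G) := by
        rw [← Matrix.mul_assoc, h2]
      have h' := congrArg conjTranspose h
      rw [conjTranspose_mul (F * H), g3, h3, ← Matrix.mul_assoc, g2] at h'
      exact h'
    rw [← g1, e1, Matrix.mul_assoc, e2, ← Matrix.mul_assoc, h1]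
end

section
/- Let m, n be natural numbers, let J be the standard symplectic 2m × 2m matrix J = [[0, 1], [−1, 0]] (block form, so Jᵀ = −J and J·J = −1), and for a 2m × 2m complex matrix M set M# = −J·Mᵀ·J. Then for every complex matrix A of size 2m × n there exist a complex matrix B of size n × 2m and a positive-definite Hermitian matrix P of size n × n such that: 2A = 2·A·B·A − (A·B)#·A, 2B = 2·B·A·B − B·(A·B)#, P·(B·A) = (B·A)ᴴ·P, and (A·B − (A·B)#)ᴴ = A·B − (A·B)#. -/
open Matrix
open scoped ComplexOrder

/-- The standard symplectic matrix `J = [[0, 1], [-1, 0]]` (block form) of size `2m × 2m`. -/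
noncomputable def Jmat (m : ℕ) : Matrix (Fin m ⊕ Fin m) (Fin m ⊕ Fin m) ℂ :=
  Matrix.fromBlocks 0 1 (-1) 0

/-- The adjoint `M# = −J·Mᵀ·J` of a `2m × 2m` matrix with respect to the symplectic form
`ω(x, y) = xᵀ·J·y`. -/
noncomputable def sharp (m : ℕ) (M : Matrix (Fin m ⊕ Fin m) (Fin m ⊕ Fin m) ℂ) :
    Matrix (Fin m ⊕ Fin m) (Fin m ⊕ Fin m) ℂ :=
  -(Jmat m * Mᵀ * Jmat m)

theorem conjTr_tr {k l : Type*} (M : Matrix k l ℂ) : (Mᴴ)ᵀ = (Mᵀ)ᴴ := by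
  ext i j
  simp

/-- Pseudo-inverse of a Hermitian matrix, from the spectral theorem. -/
theorem exists_pinv_herm {k : Type*} [Fintype k] [DecidableEq k] (H : Matrix k k ℂ)
    (hH : H.IsHermitian) :
    ∃ G : Matrix k k ℂ, Gᴴ = G ∧ G * H = H * G ∧ H * G * H = H ∧ G * H * G = G := by
  have hs := hH.spectral_theorem
  rw [Unitary.conjStarAlgAut_apply] at hs
  set U : Matrix k k ℂ := (hH.eigenvectorUnitary : Matrix k k ℂ) with hU
  have hUU : star U * U = 1 := Unitary.coe_star_mul_self hH.eigenvectorUnitary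
  set d : k → ℂ := RCLike.ofReal ∘ hH.eigenvalues with hd
  have key : ∀ a b : k → ℂ, (U * diagonal a * star U) * (U * diagonal b * star U)
      = U * diagonal (fun i => a i * b i) * star U := by
    intro a b
    calc _ = U * diagonal a * (star U * U) * diagonal b * star U := by
          simp only [Matrix.mul_assoc]
      _ = _ := by rw [hUU, Matrix.mul_one, Matrix.mul_assoc U, diagonal_mul_diagonal]
  refine ⟨U * diagonal (fun i => (d i)⁻¹) * star U, ?_, ?_, ?_, ?_⟩
  · simp only [conjTranspose_mul, star_eq_conjTranspose, conjTranspose_conjTranspose,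
      diagonal_conjTranspose, Matrix.mul_assoc]
    congr 3
    ext i
    simp [hd]
  · rw [hs, key, key]
    simp only [mul_comm]
  · rw [hs, key, key]
    congr 3
    ext i
    exact mul_inv_mul_cancel (d i)
  · rw [hs, key, key]
    congr 3
    ext i
    by_cases h : d i = 0
    · simp [h]
    · simp [h]

/-- Existence of the Moore–Penrose inverse. -/
theorem exists_pinv {k l : Type*} [Fintype k] [DecidableEq k] [Fintype l] [DecidableEq l]
    (A : Matrix k l ℂ) :
    ∃ X : Matrix l k ℂ, A * X * A = A ∧ X * A * X = X ∧ (A * X)ᴴ = A * X ∧ (X * A)ᴴ = X * A := by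
  obtain ⟨G, hG, hc, h1, h2⟩ := exists_pinv_herm (Aᴴ * A) (isHermitian_conjTranspose_mul_self A)
  set H := Aᴴ * A with hH
  have hHH : Hᴴ = H := isHermitian_conjTranspose_mul_self A
  have hA : A * (G * H) - A = 0 := by
    rw [← conjTranspose_mul_self_eq_zero]
    have : (A * (G * H) - A)ᴴ * (A * (G * H) - A)
        = H * G * (H * G * H) - H * G * H - H * G * H + H := by
      simp only [conjTranspose_sub, conjTranspose_mul, hG, hHH]
      simp only [Matrix.sub_mul, Matrix.mul_sub, hH, Matrix.mul_assoc]
      abel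
    rw [this, h1, h1]; abel
  refine ⟨G * Aᴴ, ?_, ?_, ?_, ?_⟩
  · have := sub_eq_zero.1 hA
    rw [hH] at this
    simpa only [Matrix.mul_assoc] using this
  · have : G * Aᴴ * A * (G * Aᴴ) = G * H * G * Aᴴ := by simp only [hH, Matrix.mul_assoc]
    rw [this, h2]
  · simp only [conjTranspose_mul, conjTranspose_conjTranspose, hG, Matrix.mul_assoc]
  · have : G * Aᴴ * A = G * H := by simp only [hH, Matrix.mul_assoc]
    rw [this, conjTranspose_mul, hHH, hG, hc]

/-- Uniqueness of the Moore–Penrose inverse. -/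
theorem pinv_unique {k : Type*} [Fintype k] (A X Y : Matrix k k ℂ)
    (x1 : A * X * A = A) (x2 : X * A * X = X) (x3 : (A * X)ᴴ = A * X) (x4 : (X * A)ᴴ = X * A)
    (y1 : A * Y * A = A) (y2 : Y * A * Y = Y) (y3 : (A * Y)ᴴ = A * Y) (y4 : (Y * A)ᴴ = Y * A) :
    X = Y := by
  have e1 : A * X = A * Y := by
    have h : (A * Y) * (A * X) = A * X := by rw [← Matrix.mul_assoc, y1]
    have h' : (A * X) * (A * Y) = A * Y := by rw [← Matrix.mul_assoc, x1]
    have := congrArg conjTranspose h'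
    rw [conjTranspose_mul, x3, y3] at this
    rw [← h, this]
  have e2 : X * A = Y * A := by
    have h : (X * A) * (Y * A) = X * A := by
      rw [Matrix.mul_assoc, ← Matrix.mul_assoc A, y1]
    have h' : (Y * A) * (X * A) = Y * A := by
      rw [Matrix.mul_assoc, ← Matrix.mul_assoc A, x1]
    have := congrArg conjTranspose h'
    rw [conjTranspose_mul, x4, y4] at this
    rw [← h, this]
  rw [← x2, e2, Matrix.mul_assoc, e1, ← Matrix.mul_assoc, y2]

theorem Jmat_transpose (m : ℕ) : (Jmat m)ᵀ = -Jmat m := by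
  simp [Jmat, fromBlocks_transpose, fromBlocks_neg]

theorem Jmat_conjTranspose (m : ℕ) : (Jmat m)ᴴ = -Jmat m := by
  simp [Jmat, fromBlocks_conjTranspose, fromBlocks_neg]

theorem Jmat_sq (m : ℕ) : Jmat m * Jmat m = -1 := by
  simp [Jmat, fromBlocks_multiply, ← fromBlocks_one, fromBlocks_neg]

theorem sharp_mul (m : ℕ) (M N : Matrix (Fin m ⊕ Fin m) (Fin m ⊕ Fin m) ℂ) :
    sharp m (M * N) = sharp m N * sharp m M := by
  have : sharp m N * sharp m M = Jmat m * Nᵀ * (Jmat m * Jmat m) * Mᵀ * Jmat m := by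
    simp only [sharp, Matrix.neg_mul, Matrix.mul_neg, neg_neg, Matrix.mul_assoc]
  rw [this, Jmat_sq, sharp, transpose_mul]
  simp only [Matrix.mul_neg, Matrix.neg_mul, Matrix.mul_one, Matrix.mul_assoc]

theorem sharp_conjTranspose (m : ℕ) (M : Matrix (Fin m ⊕ Fin m) (Fin m ⊕ Fin m) ℂ)
    (h : Mᴴ = M) : (sharp m M)ᴴ = sharp m M := by
  have h' : (Mᵀ)ᴴ = Mᵀ := by
    rw [← conjTr_tr, h]
  simp only [sharp, conjTranspose_neg, conjTranspose_mul, Jmat_conjTranspose, h',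
    Matrix.neg_mul, Matrix.mul_neg, neg_neg, Matrix.mul_assoc]

/-- The projections onto the radical and its complement inside the range of `e`. -/
theorem exists_proj (m : ℕ) (e : Matrix (Fin m ⊕ Fin m) (Fin m ⊕ Fin m) ℂ)
    (he : e * e = e) (heh : eᴴ = e) :
    ∃ p q : Matrix (Fin m ⊕ Fin m) (Fin m ⊕ Fin m) ℂ,
      p * p = p ∧ pᴴ = p ∧ q * q = q ∧ sharp m q = q ∧ p * q = 0 ∧ q * p = 0 ∧
      e * p = p ∧ e * q = q ∧ p * e + q * e = e ∧ (q * e)ᴴ = q * e ∧ (p * e)ᴴ = p * e ∧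
      sharp m p * p = 0 ∧ p * sharp m p = 0 := by
  set J := Jmat m with hJ
  set K := eᵀ * J * e with hK
  obtain ⟨L, l1, l2, l3, l4⟩ := exists_pinv K
  have hKt : Kᵀ = -K := by
    simp only [hK, transpose_mul, transpose_transpose, hJ, Jmat_transpose, Matrix.mul_neg,
      Matrix.neg_mul, Matrix.mul_assoc]
  have hLt : -Lᵀ = L := by
    have t1 := congrArg transpose l1
    have t2 := congrArg transpose l2
    have t3 := congrArg transpose l3
    have t4 := congrArg transpose l4
    simp only [transpose_mul, hKt] at t1 t2
    rw [conjTr_tr] at t3 t4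
    simp only [transpose_mul, hKt] at t3 t4
    have u1 : K * -Lᵀ = -K * Lᵀ := by simp
    have u2 : -Lᵀ * K = Lᵀ * -K := by simp
    refine pinv_unique K _ _ ?_ ?_ ?_ ?_ l1 l2 l3 l4
    · rw [u1]
      have := t1
      simp only [Matrix.neg_mul, Matrix.mul_neg, neg_neg, Matrix.mul_assoc] at this ⊢
      rw [← neg_inj, ← this]; simp [this]
    · rw [u2]
      simp only [Matrix.neg_mul, Matrix.mul_neg, neg_neg, Matrix.mul_assoc] at t2 ⊢
      rw [← neg_inj]; simpa using t2
    · rw [u1, t4]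
    · rw [u2, t3]
  have Ke : K * e = K := by rw [hK, Matrix.mul_assoc, he]
  have etet : eᵀ * eᵀ = eᵀ := by rw [← transpose_mul, he]
  have eK : eᵀ * K = K := by rw [hK, ← Matrix.mul_assoc, ← Matrix.mul_assoc, etet]
  have eLK : e * (L * K) = L * K := by
    have : (L * K) * e = L * K := by rw [Matrix.mul_assoc, Ke]
    have := congrArg conjTranspose this
    rwa [conjTranspose_mul, l4, heh] at this
  have eL : e * L = L := by
    rw [← l2, ← Matrix.mul_assoc, eLK]
  have Let : L * eᵀ = L := by
    have := congrArg transpose eL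
    rw [transpose_mul, ← neg_inj, ← Matrix.neg_mul, hLt] at this
    exact this
  have LJe : L * J * e = L * K := by
    rw [hK, ← Matrix.mul_assoc, ← Matrix.mul_assoc, Let]
  have LKLK : L * K * (L * K) = L * K := by rw [← Matrix.mul_assoc, l2]
  have LKe : L * K * e = L * K := by rw [Matrix.mul_assoc, Ke]
  have pp : (e - L * K) * (e - L * K) = e - L * K := by
    rw [Matrix.sub_mul, Matrix.mul_sub, Matrix.mul_sub, he, eLK, LKLK, LKe]; abel
  have ep : e * (e - L * K) = e - L * K := by rw [Matrix.mul_sub, he, eLK]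
  have pe : (e - L * K) * e = e - L * K := by rw [Matrix.sub_mul, he, LKe]
  have ph : (e - L * K)ᴴ = e - L * K := by rw [conjTranspose_sub, heh, l4]
  have Kp : K * (e - L * K) = 0 := by
    rw [Matrix.mul_sub, Ke, ← Matrix.mul_assoc, l1, sub_self]
  have LKp : L * J * (e - L * K) = 0 := by
    rw [← ep, ← Matrix.mul_assoc, LJe, Matrix.mul_assoc, Kp, Matrix.mul_zero]
  have spp : sharp m (e - L * K) * (e - L * K) = 0 := by
    have ept : (e - L * K)ᵀ * eᵀ = (e - L * K)ᵀ := by rw [← transpose_mul, ep]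
    calc sharp m (e - L * K) * (e - L * K)
        = -(J * (e - L * K)ᵀ * J * (e - L * K)) := by rw [sharp, Matrix.neg_mul]
      _ = -(J * ((e - L * K)ᵀ * eᵀ) * J * (e * (e - L * K))) := by rw [ept, ep]
      _ = -(J * (e - L * K)ᵀ * (K * (e - L * K))) := by
          simp only [hK, Matrix.mul_assoc]
      _ = 0 := by rw [Kp, Matrix.mul_zero, neg_zero]
  refine ⟨e - L * K, L * J, pp, ph, ?_, ?_, ?_, LKp, ep, ?_, ?_, ?_, ?_, spp, ?_⟩
  · calc L * J * (L * J) = L * J * (e * L * J) := by rw [eL]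
      _ = (L * J * e) * L * J := by simp only [Matrix.mul_assoc]
      _ = L * J := by rw [LJe, l2]
  · have : Lᵀ = -L := by rw [← neg_eq_iff_eq_neg, hLt]
    rw [sharp, transpose_mul, this, ← hJ]
    have hJt : Jᵀ = -J := Jmat_transpose m
    have hJJ : J * J = -1 := Jmat_sq m
    rw [hJt]
    calc -(J * (-J * -L) * J) = -((J * J) * L * J) := by
          simp only [Matrix.neg_mul, Matrix.mul_neg, neg_neg, Matrix.mul_assoc]
      _ = L * J := by rw [hJJ]; simp
  · rw [← Matrix.mul_assoc, Matrix.sub_mul, eL, l2, sub_self, Matrix.zero_mul]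
  · rw [← Matrix.mul_assoc, eL]
  · rw [pe, LJe]; abel
  · rw [LJe, l4]
  · rw [pe, ph]
  · have := congrArg conjTranspose spp
    rwa [conjTranspose_mul, sharp_conjTranspose m _ ph, ph, conjTranspose_zero] at this

/-- Key lemma, symplectic case: for every complex `2m × n` matrix `A` there exist
`B : ℂ²ᵐ → ℂⁿ` and a Hermitian inner product on `ℂⁿ` (a positive-definite Hermitian matrix `P`)
such that `2A = 2ABA − (AB)#A`, `2B = 2BAB − B(AB)#`, `BA` is Hermitian for `P`, and
`AB − (AB)#` is Hermitian for the standard form on `ℂ²ᵐ`. -/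
theorem key_lemma_symplectic (m n : ℕ) (A : Matrix (Fin m ⊕ Fin m) (Fin n) ℂ) :
    ∃ (B : Matrix (Fin n) (Fin m ⊕ Fin m) ℂ) (P : Matrix (Fin n) (Fin n) ℂ),
      P.PosDef ∧
      (2 : ℂ) • A = (2 : ℂ) • (A * B * A) - sharp m (A * B) * A ∧
      (2 : ℂ) • B = (2 : ℂ) • (B * A * B) - B * sharp m (A * B) ∧
      P * (B * A) = (B * A)ᴴ * P ∧
      (A * B - sharp m (A * B))ᴴ = A * B - sharp m (A * B) := by
  obtain ⟨X, x1, x2, x3, x4⟩ := exists_pinv A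
  obtain ⟨p, q, pp, ph, qq, qs, pq, qp, ep, eq, hpq, qeh, peh, spp, psp⟩ :=
    exists_proj m (A * X) (by rw [← Matrix.mul_assoc, x1]) x3
  have spq : sharp m p * q = 0 := by
    have := sharp_mul m q p
    rw [qp, qs] at this
    rw [← this]; simp [sharp]
  have qsp : q * sharp m p = 0 := by
    have := sharp_mul m p q
    rw [pq, qs] at this
    rw [← this]; simp [sharp]
  have hAB : A * (X * (2 • q + p)) = 2 • q + p := by
    rw [← Matrix.mul_assoc, Matrix.mul_add, Matrix.mul_smul, ep, eq]
  have hsh : sharp m (2 • q + p) = 2 • q + sharp m p := by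
    conv_rhs => rw [← qs]
    simp only [sharp, transpose_add, transpose_smul, Matrix.mul_add, Matrix.add_mul,
      Matrix.mul_smul, Matrix.smul_mul, smul_neg, neg_add]
  have hA : p * A + q * A = A := by
    have := congrArg (· * A) hpq
    simp only [Matrix.add_mul, Matrix.mul_assoc] at this
    simpa only [← Matrix.mul_assoc A, x1] using this
  have spA : sharp m p * A = 0 := by
    rw [← hA, Matrix.mul_add, ← Matrix.mul_assoc, ← Matrix.mul_assoc, spp, spq]; simp
  set E : Matrix (Fin n) (Fin n) ℂ := 1 - X * A with hE
  have XAXA : X * A * (X * A) = X * A := by rw [← Matrix.mul_assoc, x2]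
  have EE : E * E = E := by
    rw [hE, Matrix.sub_mul, Matrix.mul_sub, Matrix.mul_sub, XAXA]; simp
  have Eh : Eᴴ = E := by rw [hE, conjTranspose_sub, x4, conjTranspose_one]
  have AE : A * E = 0 := by rw [hE, Matrix.mul_sub, ← Matrix.mul_assoc, x1]; simp
  have EX : E * X = 0 := by rw [hE, Matrix.sub_mul, x2]; simp
  have AhAX : Aᴴ * A * X = Aᴴ := by
    rw [Matrix.mul_assoc, ← x3, ← conjTranspose_mul, x1]
  have hPB : (Aᴴ * A + E) * (X * (2 • q + p) * A) = Aᴴ * (2 • q + p) * A := by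
    rw [Matrix.add_mul, ← Matrix.mul_assoc, ← Matrix.mul_assoc, AhAX,
      ← Matrix.mul_assoc, ← Matrix.mul_assoc, EX]
    simp
  have hPh : (Aᴴ * A + E)ᴴ = Aᴴ * A + E := by
    rw [conjTranspose_add, conjTranspose_mul, conjTranspose_conjTranspose, Eh]
  have hQA : (Aᴴ * (2 • q + p) * A)ᴴ = Aᴴ * (2 • q + p) * A := by
    have h : Aᴴ * (2 • q + p) * A = Aᴴ * (2 • (q * (A * X)) + p * (A * X)) * A := by
      have : 2 • (q * (A * X)) + p * (A * X) = (2 • q + p) * (A * X) := by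
        rw [Matrix.add_mul, Matrix.smul_mul]
      rw [this]
      simp only [Matrix.mul_assoc]
      rw [← Matrix.mul_assoc A X A, x1]
    rw [h]
    simp only [conjTranspose_mul _ A, conjTranspose_mul Aᴴ, conjTranspose_conjTranspose,
      conjTranspose_add, conjTranspose_smul, qeh, peh, Matrix.mul_assoc]
    simp
  refine ⟨X * (2 • q + p), Aᴴ * A + E, ?_, ?_, ?_, ?_, ?_⟩
  · have hps : (Aᴴ * A + E).PosSemidef := by
      refine (posSemidef_conjTranspose_mul_self A).add ?_
      have := posSemidef_conjTranspose_mul_self E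
      rwa [Eh, EE] at this
    refine hps.posDef_iff_isUnit.2 ?_
    refine IsUnit.of_mul_eq_one (X * Xᴴ + E) ?_
    rw [Matrix.add_mul, Matrix.mul_add, Matrix.mul_add, EE, ← Matrix.mul_assoc, AhAX,
      ← Matrix.mul_assoc, EX, Matrix.mul_assoc Aᴴ, AE, ← conjTranspose_mul, x4, hE]
    simp
  · rw [hAB, hsh]
    simp only [Matrix.add_mul, Matrix.smul_mul, spA]
    nth_rewrite 1 [← hA]
    module
  · rw [Matrix.mul_assoc X, Matrix.mul_assoc X, Matrix.mul_assoc (2 • q + p), hAB, hsh,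
      Matrix.mul_assoc X, ← Matrix.mul_smul, ← Matrix.mul_smul, ← Matrix.mul_sub]
    congr 1
    simp only [Matrix.add_mul, Matrix.mul_add, Matrix.smul_mul, Matrix.mul_smul, qq, pp, pq, qp,
      qsp, psp]
    module
  · rw [hPB]
    have := congrArg conjTranspose hPB
    rw [conjTranspose_mul, hPh, hQA] at this
    exact this.symm
  · rw [hAB, hsh]
    have : 2 • q + p - (2 • q + sharp m p) = p - sharp m p := by abel
    rw [this, conjTranspose_sub, ph, sharp_conjTranspose m p ph]
end

section
/- Let V and W be finite-dimensional complex vector spaces and let ω be a nondegenerate symmetric bilinear form on W. A pair of natural numbers (i, j) satisfies: there exists a linear map A : V → W with rank A = i and with the radical {w ∈ range A | ω(w, w') = 0 for all w' ∈ range A} of the restriction of ω to range A of dimension j, if and only if i ≤ min(dim V, dim W) and j ≤ min(i, dim W − i). -/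
/-- The radical `{w ∈ S | ω(w, w') = 0 for all w' ∈ S}` of the restriction of the bilinear
form `ω` to a subspace `S`. -/
noncomputable def radicalOn {W : Type*} [AddCommGroup W] [Module ℂ W]
    (ω : W →ₗ[ℂ] W →ₗ[ℂ] ℂ) (S : Submodule ℂ W) : Submodule ℂ W :=
  S ⊓ ⨅ w' ∈ S, LinearMap.ker (ω.flip w')

theorem mem_radicalOn {W : Type*} [AddCommGroup W] [Module ℂ W]
    (ω : W →ₗ[ℂ] W →ₗ[ℂ] ℂ) (S : Submodule ℂ W) (w : W) :
    w ∈ radicalOn ω S ↔ w ∈ S ∧ ∀ y ∈ S, ω w y = 0 := by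
  simp [radicalOn]

theorem radicalOn_finrank_of_orthogonal {W : Type*} [AddCommGroup W] [Module ℂ W]
    (ω : W →ₗ[ℂ] W →ₗ[ℂ] ℂ) (i j : ℕ) (hj : j ≤ i) (F : Fin i → W)
    (hF : LinearIndependent ℂ F) (ho : ∀ k l, k ≠ l → ω (F k) (F l) = 0)
    (hd : ∀ k, ω (F k) (F k) = 0 ↔ k.val < j) :
    Module.finrank ℂ (radicalOn ω (Submodule.span ℂ (Set.range F))) = j := by
  have key : radicalOn ω (Submodule.span ℂ (Set.range F)) =
      Submodule.span ℂ (Set.range (F ∘ Fin.castLE hj)) := by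
    apply le_antisymm
    · intro w hw
      rw [mem_radicalOn] at hw
      obtain ⟨hw, hw0⟩ := hw
      obtain ⟨a, rfl⟩ := (Submodule.mem_span_range_iff_exists_fun ℂ).1 hw
      refine Submodule.sum_mem _ fun k _ => ?_
      by_cases hk : k.val < j
      · exact Submodule.smul_mem _ _ (Submodule.subset_span ⟨⟨k, hk⟩, rfl⟩)
      · have h := hw0 (F k) (Submodule.subset_span ⟨k, rfl⟩)
        rw [map_sum, LinearMap.sum_apply, Finset.sum_eq_single k] at h
        · have h2 : a k * ω (F k) (F k) = 0 := by simpa using h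
          have h3 := (mul_eq_zero.1 h2).resolve_right (fun h => hk ((hd k).1 h))
          simp [h3]
        · intro l _ hl
          simp [ho l k hl]
        · simp
    · rw [Submodule.span_le]
      rintro _ ⟨k, rfl⟩
      rw [SetLike.mem_coe, mem_radicalOn]
      refine ⟨Submodule.subset_span ⟨_, rfl⟩, fun y hy => ?_⟩
      have : Submodule.span ℂ (Set.range F) ≤ LinearMap.ker (ω ((F ∘ Fin.castLE hj) k)) := by
        rw [Submodule.span_le]
        rintro _ ⟨l, rfl⟩
        rw [SetLike.mem_coe, LinearMap.mem_ker]
        by_cases hl : Fin.castLE hj k = l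
        · subst hl
          exact (hd _).2 k.2
        · exact ho _ _ hl
      exact this hy
  rw [key, finrank_span_eq_card (hF.comp _ (Fin.castLE_injective hj))]
  simp

theorem exists_family {W : Type*} [AddCommGroup W] [Module ℂ W] [FiniteDimensional ℂ W]
    (ω : W →ₗ[ℂ] W →ₗ[ℂ] ℂ)
    (hsymm : ∀ x y : W, ω x y = ω y x)
    (hnd : ∀ x : W, (∀ y : W, ω x y = 0) → x = 0)
    (i j : ℕ) (hi : i ≤ Module.finrank ℂ W) (hj : j ≤ i) (hij : i + j ≤ Module.finrank ℂ W) :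
    ∃ F : Fin i → W, LinearIndependent ℂ F ∧ (∀ k l, k ≠ l → ω (F k) (F l) = 0) ∧
      ∀ k, ω (F k) (F k) = 0 ↔ k.val < j := by
  obtain ⟨v, hv⟩ := LinearMap.BilinForm.exists_orthogonal_basis (B := ω) ⟨hsymm⟩
  have hvo : ∀ k l, k ≠ l → ω (v k) (v l) = 0 := fun k l h => hv h
  have hvd : ∀ k, ω (v k) (v k) ≠ 0 := by
    intro k hk
    apply v.ne_zero k
    apply hnd
    intro y
    have : ω (v k) = 0 := v.ext fun l => by
      by_cases h : k = l
      · subst h; simpa using hk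
      · simpa using hvo k l h
    simp [this]
  let p : Fin i → Fin (Module.finrank ℂ W) := Fin.castLE hi
  let q : Fin i → Fin (Module.finrank ℂ W) := fun k =>
    if h : k.val < j then ⟨i + k, by omega⟩ else p k
  have hc : ∀ k : Fin i, ∃ c : ℂ, (k.val < j → c ^ 2 = - ω (v (p k)) (v (p k)) / ω (v (q k)) (v (q k)))
      ∧ (¬ k.val < j → c = 0) := by
    intro k
    by_cases h : k.val < j
    · obtain ⟨c, hc⟩ := IsAlgClosed.exists_pow_nat_eq
        (- ω (v (p k)) (v (p k)) / ω (v (q k)) (v (q k))) (n := 2) (by norm_num)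
      exact ⟨c, fun _ => hc, fun h' => absurd h h'⟩
    · exact ⟨0, fun h' => absurd h' h, fun _ => rfl⟩
  choose c hc1 hc2 using hc
  have hpp : ∀ k l, k ≠ l → p k ≠ p l := fun k l h h' => h (Fin.castLE_injective hi h')
  have hq : ∀ k : Fin i, k.val < j → (q k).val = i + k := fun k h => by simp [q, h]
  have hpv : ∀ k, (p k).val = k.val := fun k => rfl
  -- the twisted vectors pair with the first basis vectors diagonally
  have hqp : ∀ k l, c k * ω (v (q k)) (v (p l)) = 0 := by
    intro k l
    by_cases h : k.val < j
    · rw [hvo, mul_zero]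
      intro h'
      have := congrArg Fin.val h'
      rw [hq k h, hpv] at this
      omega
    · simp [hc2 k h]
  have hqq : ∀ k l, k ≠ l → c k * (c l * ω (v (q k)) (v (q l))) = 0 := by
    intro k l hkl
    by_cases h : k.val < j
    · by_cases h2 : l.val < j
      · rw [hvo]
        · simp
        · intro h'
          have := congrArg Fin.val h'
          rw [hq k h, hq l h2] at this
          exact hkl (Fin.ext (by omega))
      · simp [hc2 l h2]
    · simp [hc2 k h]
  have expand : ∀ k l, ω (v (p k) + c k • v (q k)) (v (p l) + c l • v (q l)) =
      ω (v (p k)) (v (p l)) + c k * (c l * ω (v (q k)) (v (q l))) := by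
    intro k l
    have h1 := hqp k l
    have h2 := hqp l k
    rw [hsymm] at h2
    simp only [map_add, map_smul, LinearMap.add_apply, LinearMap.smul_apply, smul_eq_mul]
    linear_combination h1 + h2
  refine ⟨fun k => v (p k) + c k • v (q k), ?_, ?_, ?_⟩
  · rw [Fintype.linearIndependent_iff]
    intro a ha l
    have h := congrArg (fun w => ω w (v (p l))) ha
    simp only [map_sum, LinearMap.sum_apply, map_zero, LinearMap.zero_apply] at h
    rw [Finset.sum_eq_single l] at h
    · simp only [map_add, map_smul, LinearMap.add_apply, LinearMap.smul_apply, smul_eq_mul,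
        hqp, add_zero] at h
      exact (mul_eq_zero.1 h).resolve_right (hvd _)
    · intro k _ hk
      simp only [map_add, map_smul, LinearMap.add_apply, LinearMap.smul_apply, smul_eq_mul,
        hqp, add_zero, hvo _ _ (hpp k l hk), mul_zero]
    · simp
  · intro k l hkl
    simp only [expand, hvo _ _ (hpp k l hkl), hqq k l hkl, add_zero]
  · intro k
    simp only [expand]
    constructor
    · intro h
      by_contra hk
      simp only [hc2 k hk, zero_mul, add_zero] at h
      exact hvd _ h
    · intro h
      have h1 := hc1 k h
      rw [eq_div_iff (hvd _)] at h1
      linear_combination h1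

/-- **Witt's theorem** (parametrization of orbits): a pair `(i, j)` of natural numbers arises
as `(rank A, dim of the radical of ω restricted to range A)` for some linear map `A : V → W`
if and only if `i ≤ min (dim V) (dim W)` and `j ≤ min i (dim W − i)`. -/
theorem witt_orbit_parametrization {V W : Type*}
    [AddCommGroup V] [Module ℂ V] [FiniteDimensional ℂ V]
    [AddCommGroup W] [Module ℂ W] [FiniteDimensional ℂ W]
    (ω : W →ₗ[ℂ] W →ₗ[ℂ] ℂ)
    (hsymm : ∀ x y : W, ω x y = ω y x)
    (hnd : ∀ x : W, (∀ y : W, ω x y = 0) → x = 0)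
    (i j : ℕ) :
    (∃ A : V →ₗ[ℂ] W,
        Module.finrank ℂ (LinearMap.range A) = i ∧
        Module.finrank ℂ (radicalOn ω (LinearMap.range A)) = j) ↔
      (i ≤ min (Module.finrank ℂ V) (Module.finrank ℂ W) ∧
       j ≤ min i (Module.finrank ℂ W - i)) := by
  constructor
  · rintro ⟨A, rfl, rfl⟩
    have hnd' : LinearMap.BilinForm.Nondegenerate ω :=
      ⟨hnd, fun y hy => hnd y fun x => by rw [hsymm]; exact hy x⟩
    have h1 := LinearMap.finrank_range_le A
    have h2 := Submodule.finrank_le (LinearMap.range A)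
    have h3 : radicalOn ω (LinearMap.range A) ≤ LinearMap.range A := inf_le_left
    have h4 : radicalOn ω (LinearMap.range A) ≤
        LinearMap.BilinForm.orthogonal ω (LinearMap.range A) := by
      intro w hw
      rw [mem_radicalOn] at hw
      rw [LinearMap.BilinForm.mem_orthogonal_iff]
      intro y hy
      exact (hsymm y w).trans (hw.2 y hy)
    have h5 := Submodule.finrank_mono h3
    have h6 := Submodule.finrank_mono h4
    rw [LinearMap.BilinForm.finrank_orthogonal hnd'] at h6
    exact ⟨le_min h1 h2, le_min h5 h6⟩
  · rintro ⟨h1, h2⟩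
    rw [le_min_iff] at h1 h2
    obtain ⟨F, hF, ho, hd⟩ := exists_family ω hsymm hnd i j h1.2 h2.1 (by omega)
    let b := Module.finBasis ℂ V
    let g : Fin (Module.finrank ℂ V) → W := fun k => if h : k.val < i then F ⟨k, h⟩ else 0
    have hr : LinearMap.range (b.constr ℂ g) = Submodule.span ℂ (Set.range F) := by
      rw [Module.Basis.constr_range]
      apply le_antisymm
      · rw [Submodule.span_le]
        rintro _ ⟨k, rfl⟩
        by_cases h : k.val < i
        · simp only [g, h, dif_pos]
          exact Submodule.subset_span ⟨_, rfl⟩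
        · simp [g, h]
      · apply Submodule.span_mono
        rintro _ ⟨k, rfl⟩
        exact ⟨⟨k, by omega⟩, by simp [g]⟩
    refine ⟨b.constr ℂ g, ?_, ?_⟩
    · rw [hr, finrank_span_eq_card hF, Fintype.card_fin]
    · rw [hr]
      exact radicalOn_finrank_of_orthogonal ω i j h2.1 F hF ho hd
end

section
/- Let β_det be the polar bilinear form of the determinant on 2 × 2 complex matrices, β_det(X, Y) = det(X + Y) − det X − det Y. Suppose the linear map A : ⋀²ℂ³ → M₂(ℂ) is not ample with respect to β_det, and B : ℂ³ → ℂ² is a nonzero linear map. Then there exists a linear map C : ℂ³ → ℂ² such that A + B∧C is ample with respect to β_det, where B∧C : ⋀²ℂ³ → M₂(ℂ) is the unique linear map sending u ∧ v to (B u)·(C v)ᵀ − (B v)·(C u)ᵀ (outer products of column vectors in ℂ², yielding 2 × 2 matrices). -/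
/-- A linear map `A : E → W` is ample with respect to a bilinear form `β` on `W` if the
restriction of `β` to the range of `A` is either identically zero or nondegenerate. -/
def IsAmple {E W : Type*} [AddCommGroup E] [Module ℂ E] [AddCommGroup W] [Module ℂ W]
    (β : W →ₗ[ℂ] W →ₗ[ℂ] ℂ) (A : E →ₗ[ℂ] W) : Prop :=
  (∀ w ∈ LinearMap.range A, ∀ w' ∈ LinearMap.range A, β w w' = 0) ∨
  (∀ w ∈ LinearMap.range A, w ≠ 0 → ∃ w' ∈ LinearMap.range A, β w w' ≠ 0)

/-- The wedge product `u ∧ v` of two vectors of `ℂ³`, as an element of `⋀²ℂ³`. -/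
noncomputable def wedge3 (u v : Fin 3 → ℂ) : ↥(⋀[ℂ]^2 (Fin 3 → ℂ)) :=
  ⟨ExteriorAlgebra.ιMulti ℂ 2 ![u, v],
    ExteriorAlgebra.ιMulti_range ℂ 2 (Set.mem_range_self _)⟩

open Submodule in
/-- Range of a linear map on the exterior square in terms of a basis. -/
lemma range_eq_span_wedge (f : Module.Basis (Fin 3) ℂ (Fin 3 → ℂ)) {W : Type*} [AddCommGroup W]
    [Module ℂ W] (T : ↥(⋀[ℂ]^2 (Fin 3 → ℂ)) →ₗ[ℂ] W) :
    LinearMap.range T =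
      span ℂ {T (wedge3 (f 1) (f 2)), T (wedge3 (f 0) (f 1)), T (wedge3 (f 0) (f 2))} := by
  have hw : ∀ u v, wedge3 u v = exteriorPower.ιMulti ℂ 2 ![u, v] := fun u v => rfl
  have hself : ∀ u, wedge3 u u = 0 := by
    intro u
    rw [hw]
    exact AlternatingMap.map_eq_zero_of_eq _ _ (i := 0) (j := 1) rfl (by decide)
  have hswap : ∀ u v, wedge3 u v = - wedge3 v u := by
    intro u v
    rw [hw, hw, ← AlternatingMap.map_swap _ _ (i := 0) (j := 1) (by decide)]
    congr 1
    ext i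
    fin_cases i <;> simp
  apply le_antisymm
  · rw [LinearMap.range_eq_map, ← exteriorPower.ιMulti_span_of_span ℂ 2 _ f.span_eq, map_span,
      span_le]
    rintro _ ⟨_, ⟨a, ha, rfl⟩, rfl⟩
    have h0 : a 0 ∈ Set.range f := ha ⟨0, rfl⟩
    have h1 : a 1 ∈ Set.range f := ha ⟨1, rfl⟩
    obtain ⟨i, hi⟩ := h0
    obtain ⟨j, hj⟩ := h1
    have haa : exteriorPower.ιMulti ℂ 2 a = wedge3 (f i) (f j) := by
      rw [hw]
      congr 1
      ext k
      fin_cases k <;> simp [hi, hj]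
    rw [haa]
    have m1 : T (wedge3 (f 1) (f 2)) ∈ span ℂ {T (wedge3 (f 1) (f 2)), T (wedge3 (f 0) (f 1)),
      T (wedge3 (f 0) (f 2))} := subset_span (by simp)
    have m2 : T (wedge3 (f 0) (f 1)) ∈ span ℂ {T (wedge3 (f 1) (f 2)), T (wedge3 (f 0) (f 1)),
      T (wedge3 (f 0) (f 2))} := subset_span (by simp)
    have m3 : T (wedge3 (f 0) (f 2)) ∈ span ℂ {T (wedge3 (f 1) (f 2)), T (wedge3 (f 0) (f 1)),
      T (wedge3 (f 0) (f 2))} := subset_span (by simp)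
    have e1 : T (wedge3 (f 1) (f 0)) = - T (wedge3 (f 0) (f 1)) := by rw [hswap, map_neg]
    have e2 : T (wedge3 (f 2) (f 0)) = - T (wedge3 (f 0) (f 2)) := by rw [hswap, map_neg]
    have e3 : T (wedge3 (f 2) (f 1)) = - T (wedge3 (f 1) (f 2)) := by rw [hswap, map_neg]
    generalize hS : span ℂ {T (wedge3 (f 1) (f 2)), T (wedge3 (f 0) (f 1)),
      T (wedge3 (f 0) (f 2))} = S at m1 m2 m3 ⊢
    fin_cases i <;> fin_cases j <;> simp [hself, e1, e2, e3, m1, m2, m3]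
  · rw [span_le]
    rintro _ (rfl | rfl | rfl) <;> exact ⟨_, rfl⟩

/-- Existence of the wedge of two linear maps. -/
lemma exists_wedge_map (B C : (Fin 3 → ℂ) →ₗ[ℂ] (Fin 2 → ℂ)) :
    ∃ D : ↥(⋀[ℂ]^2 (Fin 3 → ℂ)) →ₗ[ℂ] Matrix (Fin 2) (Fin 2) ℂ,
        (∀ u v : Fin 3 → ℂ,
          D (wedge3 u v) = Matrix.vecMulVec (B u) (C v) - Matrix.vecMulVec (B v) (C u)) := by
  let g : (Fin 3 → ℂ) [⋀^Fin 2]→ₗ[ℂ] Matrix (Fin 2) (Fin 2) ℂ :=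
    { toFun := fun a => Matrix.vecMulVec (B (a 0)) (C (a 1)) - Matrix.vecMulVec (B (a 1)) (C (a 0))
      map_update_add' := by
        intro _ m i x y
        ext k l
        fin_cases i <;> simp [Matrix.vecMulVec_apply] <;> ring
      map_update_smul' := by
        intro _ m i c x
        ext k l
        fin_cases i <;> simp [Matrix.vecMulVec_apply] <;> ring
      map_eq_zero_of_eq' := by
        intro v i j h hij
        have : v 0 = v 1 := by
          fin_cases i <;> fin_cases j <;> simp_all
        simp [this] }
  refine ⟨exteriorPower.alternatingMapLinearEquiv g, fun u v => ?_⟩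
  have hw : wedge3 u v = exteriorPower.ιMulti ℂ 2 ![u, v] := rfl
  rw [hw, exteriorPower.alternatingMapLinearEquiv_apply_ιMulti]
  rfl

/-- Basis adapted to a nonzero map. -/
lemma exists_adapted_basis (B : (Fin 3 → ℂ) →ₗ[ℂ] (Fin 2 → ℂ)) (hB : B ≠ 0) :
    ∃ f : Module.Basis (Fin 3) ℂ (Fin 3 → ℂ), B (f 2) = 0 ∧
      ((B (f 0) ≠ 0 ∧ B (f 1) = 0) ∨ (B (f 0) 0 * B (f 1) 1 - B (f 0) 1 * B (f 1) 0 ≠ 0)) := by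
  obtain ⟨v, hv⟩ : ∃ v, B v ≠ 0 := by
    by_contra! h
    exact hB (LinearMap.ext h)
  by_cases h : ∀ u, B v 0 * B u 1 - B v 1 * B u 0 = 0
  · have hr : LinearMap.range B ≤ Submodule.span ℂ {B v} := by
      rintro _ ⟨u, rfl⟩
      rw [Submodule.mem_span_singleton]
      have hu := h u
      by_cases h0 : B v 0 = 0
      · have h1 : B v 1 ≠ 0 := by
          intro h1
          apply hv
          ext i
          fin_cases i <;> simp [h0, h1]
        refine ⟨B u 1 / B v 1, ?_⟩
        have : B u 0 = 0 := by
          rw [h0] at hu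
          simpa [h1] using hu
        ext i
        fin_cases i <;> simp [h0, this, h1]
      · refine ⟨B u 0 / B v 0, ?_⟩
        ext i
        fin_cases i
        · simp [h0]
        · simp
          field_simp
          linear_combination -hu
    have hr1 : Module.finrank ℂ (LinearMap.range B) ≤ 1 :=
      (Submodule.finrank_mono hr).trans (finrank_span_singleton hv).le
    have hr2 : Module.finrank ℂ (LinearMap.range B) ≠ 0 := by
      intro h0
      rw [Submodule.finrank_eq_zero, LinearMap.range_eq_bot] at h0
      exact hB h0
    have hs := B.finrank_range_add_finrank_ker
    rw [Module.finrank_fin_fun] at hs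
    have hk : Module.finrank ℂ (LinearMap.ker B) = 2 := by omega
    let k := Module.finBasisOfFinrankEq ℂ _ hk
    have h0 : B (k 0) = 0 := (k 0).2
    have h1 : B (k 1) = 0 := (k 1).2
    have hli : LinearIndependent ℂ ![v, (k 0 : Fin 3 → ℂ), (k 1 : Fin 3 → ℂ)] := by
      rw [Fintype.linearIndependent_iff]
      intro g hg
      simp only [Fin.sum_univ_three, Matrix.cons_val] at hg
      have hg0 : g 0 = 0 := by
        have := congrArg B hg
        simpa [h0, h1, hv] using this
      have hkk := Fintype.linearIndependent_iff.1 k.linearIndependent ![g 1, g 2] (by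
        rw [Fin.sum_univ_two]
        apply Subtype.ext
        simpa [hg0] using hg)
      have a1 := hkk 0
      have a2 := hkk 1
      intro i
      fin_cases i
      · exact hg0
      · exact a1
      · exact a2
    refine ⟨basisOfLinearIndependentOfCardEqFinrank hli (by simp), ?_, Or.inl ⟨?_, ?_⟩⟩ <;>
      simp [h0, h1, hv]
  · push Not at h
    obtain ⟨u, hu⟩ := h
    have hk : LinearMap.ker B ≠ ⊥ := LinearMap.ker_ne_bot_of_finrank_lt (by simp)
    obtain ⟨k, hk, hk0⟩ := (Submodule.ne_bot_iff _).1 hk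
    have hk' : B k = 0 := hk
    have hli : LinearIndependent ℂ ![v, u, k] := by
      rw [Fintype.linearIndependent_iff]
      intro g hg
      simp only [Fin.sum_univ_three, Matrix.cons_val] at hg
      have hb := congrArg B hg
      simp only [map_add, map_smul, hk', map_zero, smul_zero, add_zero] at hb
      have b0 := congrFun hb 0
      have b1 := congrFun hb 1
      simp at b0 b1
      have g0 : g 0 = 0 := by
        have : g 0 * (B v 0 * B u 1 - B v 1 * B u 0) = 0 := by
          linear_combination B u 1 * b0 - B u 0 * b1
        simpa [hu] using this
      have g1 : g 1 = 0 := by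
        have : g 1 * (B v 0 * B u 1 - B v 1 * B u 0) = 0 := by
          linear_combination B v 0 * b1 - B v 1 * b0
        simpa [hu] using this
      have g2 : g 2 = 0 := by simpa [g0, g1, hk0] using hg
      intro i
      fin_cases i
      · exact g0
      · exact g1
      · exact g2
    refine ⟨basisOfLinearIndependentOfCardEqFinrank hli (by simp), ?_, Or.inr ?_⟩
    · simp [hk']
    · simpa using hu

/-- Ampleness of a subspace. -/
def AmpleSub {W : Type*} [AddCommGroup W] [Module ℂ W]
    (β : W →ₗ[ℂ] W →ₗ[ℂ] ℂ) (S : Submodule ℂ W) : Prop :=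
  (∀ w ∈ S, ∀ w' ∈ S, β w w' = 0) ∨ (∀ w ∈ S, w ≠ 0 → ∃ w' ∈ S, β w w' ≠ 0)

section gram
variable {W : Type*} [AddCommGroup W] [Module ℂ W] (β : W →ₗ[ℂ] W →ₗ[ℂ] ℂ)

lemma ampleSub_one (u : W) : AmpleSub β (Submodule.span ℂ {u}) := by
  by_cases h : β u u = 0
  · left
    intro w hw w' hw'
    obtain ⟨a, rfl⟩ := Submodule.mem_span_singleton.1 hw
    obtain ⟨b, rfl⟩ := Submodule.mem_span_singleton.1 hw'
    simp [h]
  · right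
    intro w hw h0
    obtain ⟨a, rfl⟩ := Submodule.mem_span_singleton.1 hw
    have ha : a ≠ 0 := by
      rintro rfl
      simp at h0
    exact ⟨u, Submodule.mem_span_singleton_self u, by simp [h, ha]⟩

lemma ampleSub_iso (u v : W) (h1 : β u u = 0) (h2 : β u v = 0) (h3 : β v u = 0)
    (h4 : β v v = 0) : AmpleSub β (Submodule.span ℂ {u, v}) := by
  left
  intro w hw w' hw'
  obtain ⟨a, b, rfl⟩ := Submodule.mem_span_pair.1 hw
  obtain ⟨c, d, rfl⟩ := Submodule.mem_span_pair.1 hw'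
  simp [h1, h2, h3, h4]

lemma ampleSub_two (u v : W) (h : β u u * β v v - β u v * β v u ≠ 0) :
    AmpleSub β (Submodule.span ℂ {u, v}) := by
  right
  intro w hw
  contrapose!
  intro hz
  obtain ⟨a, b, rfl⟩ := Submodule.mem_span_pair.1 hw
  have hu := hz u (Submodule.subset_span (by simp))
  have hv := hz v (Submodule.subset_span (by simp))
  simp at hu hv
  have ha : a * (β u u * β v v - β u v * β v u) = 0 := by
    linear_combination β v v * hu - β v u * hv
  have hb : b * (β u u * β v v - β u v * β v u) = 0 := by
    linear_combination β u u * hv - β u v * hu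
  simp [h] at ha hb
  simp [ha, hb]

/-- Three vectors with nonzero Gram determinant. -/
lemma ampleSub_three (hs : ∀ x y, β x y = β y x) (u v w : W)
    (h : β u u * (β v v * β w w - β v w ^ 2) - β u v * (β u v * β w w - β v w * β u w)
      + β u w * (β u v * β v w - β v v * β u w) ≠ 0) :
    AmpleSub β (Submodule.span ℂ {u, v, w}) := by
  right
  intro z hz'
  contrapose!
  intro hz
  obtain ⟨a, b, c, rfl⟩ := Submodule.mem_span_triple.1 hz'
  have hu := hz u (Submodule.subset_span (by simp))
  have hv := hz v (Submodule.subset_span (by simp))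
  have hw := hz w (Submodule.subset_span (by simp))
  simp [hs v u, hs w u, hs w v] at hu hv hw
  set G := β u u * (β v v * β w w - β v w ^ 2) - β u v * (β u v * β w w - β v w * β u w)
      + β u w * (β u v * β v w - β v v * β u w) with hG
  have ha : a * G = 0 := by
    linear_combination (β v v * β w w - β v w ^ 2) * hu - (β u v * β w w - β v w * β u w) * hv
      + (β u v * β v w - β v v * β u w) * hw
  have hb : b * G = 0 := by
    linear_combination -(β u v * β w w - β v w * β u w) * hu
      + (β u u * β w w - β u w ^ 2) * hv - (β u u * β v w - β u v * β u w) * hw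
  have hc : c * G = 0 := by
    linear_combination (β u v * β v w - β v v * β u w) * hu
      - (β u u * β v w - β u v * β u w) * hv + (β u u * β v v - β u v ^ 2) * hw
  simp [h] at ha hb hc
  simp [ha, hb, hc]

/-- A span of two vectors can be made ample by adding one vector. -/
lemma exists_ampleSub (hs : ∀ x y, β x y = β y x) (hn : ∀ x, x ≠ 0 → ∃ y, β x y ≠ 0) (X Y : W) :
    ∃ Z, AmpleSub β (Submodule.span ℂ {Z, X, Y}) := by
  by_cases h : AmpleSub β (Submodule.span ℂ {X, Y})
  · exact ⟨0, by rwa [Submodule.span_insert_zero]⟩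
  have h' := h
  rw [AmpleSub, not_or] at h'
  obtain ⟨-, h2⟩ := h'
  push Not at h2
  obtain ⟨v, hv, hv0, hvr⟩ := h2
  obtain ⟨Z, hZ⟩ := hn v hv0
  refine ⟨Z, ?_⟩
  obtain ⟨a, b, rfl⟩ := Submodule.mem_span_pair.1 hv
  have e1 := hvr X (Submodule.subset_span (by simp))
  have e2 := hvr Y (Submodule.subset_span (by simp))
  simp only [map_add, map_smul, LinearMap.add_apply, LinearMap.smul_apply, smul_eq_mul] at e1 e2 hZ
  rw [hs Y X] at e1
  apply ampleSub_three β hs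
  intro hG
  rw [hs Z X, hs Z Y] at hG
  have hdet : β X X * β Y Y = β X Y ^ 2 := by
    by_contra hne
    apply h
    apply ampleSub_two
    rw [hs Y X]
    intro h0
    apply hne
    linear_combination h0
  have hXX : β X X = 0 := by
    by_contra hX
    apply hZ
    have h0 : (β Y Z * β X X - β X Z * β X Y) ^ 2 = 0 := by
      linear_combination -β X X * hG + (β X X * β Z Z - β X Z ^ 2) * hdet
    have h1 := pow_eq_zero_iff (two_ne_zero) |>.1 h0
    have h2 : (a * β X Z + b * β Y Z) * β X X = 0 := by
      linear_combination b * h1 + β X Z * e1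
    simpa [hX] using h2
  have hXY : β X Y = 0 := by
    rw [hXX] at hdet
    simpa using hdet.symm
  have hYY : β Y Y = 0 := by
    by_contra hY
    apply hZ
    have h0 : (β X Z * β Y Y - β Y Z * β X Y) ^ 2 = 0 := by
      linear_combination -β Y Y * hG + (β Y Y * β Z Z - β Y Z ^ 2) * hdet
    have h1 := pow_eq_zero_iff (two_ne_zero) |>.1 h0
    have h2 : (a * β X Z + b * β Y Z) * β Y Y = 0 := by
      linear_combination a * h1 + β Y Z * e2
    simpa [hY] using h2
  exact h (ampleSub_iso β X Y hXX hXY (by rw [hs, hXY]) hYY)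
end gram

/-- The symplectic form on `ℂ²`. -/
def om (x y : Fin 2 → ℂ) : ℂ := x 0 * y 1 - x 1 * y 0

lemma om_solve (q r : Fin 2 → ℂ) (h : om q r ≠ 0) (s t : ℂ) :
    ∃ x, om x q = s ∧ om x r = t := by
  refine ⟨(om q r)⁻¹ • (t • q - s • r), ?_, ?_⟩
  · have : om q r * (om q r)⁻¹ = 1 := mul_inv_cancel₀ h
    generalize (om q r)⁻¹ = i at *
    simp only [om, Pi.smul_apply, Pi.sub_apply, smul_eq_mul] at *
    linear_combination s * this
  · have : om q r * (om q r)⁻¹ = 1 := mul_inv_cancel₀ h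
    generalize (om q r)⁻¹ = i at *
    simp only [om, Pi.smul_apply, Pi.sub_apply, smul_eq_mul] at *
    linear_combination t * this

lemma om_prop (q p : Fin 2 → ℂ) (hq : q ≠ 0) (h : om q p = 0) : ∃ m : ℂ, p = m • q := by
  simp only [om] at h
  by_cases h0 : q 0 = 0
  · have h1 : q 1 ≠ 0 := by
      intro h1
      apply hq
      ext i
      fin_cases i <;> simp [h0, h1]
    refine ⟨p 1 / q 1, ?_⟩
    have : p 0 = 0 := by
      rw [h0] at h
      simpa [h1] using h
    ext i
    fin_cases i <;> simp [h0, this, h1]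
  · refine ⟨p 0 / q 0, ?_⟩
    ext i
    fin_cases i
    · simp [h0]
    · simp
      field_simp
      linear_combination h

lemma om_span (q r p : Fin 2 → ℂ) (h : om q r ≠ 0) : ∃ a b : ℂ, p = a • q + b • r := by
  refine ⟨om p r / om q r, om q p / om q r, ?_⟩
  have : om q r * (om q r)⁻¹ = 1 := mul_inv_cancel₀ h
  simp only [div_eq_mul_inv]
  generalize (om q r)⁻¹ = i at *
  ext k
  fin_cases k <;> simp [om] at *
  · linear_combination -p 0 * this
  · linear_combination -p 1 * this

lemma om_smul_left (a : ℂ) (x y : Fin 2 → ℂ) : om (a • x) y = a * om x y := by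
  simp [om]; ring
lemma om_smul_right (a : ℂ) (x y : Fin 2 → ℂ) : om x (a • y) = a * om x y := by
  simp [om]; ring
lemma om_add_left (x x' y : Fin 2 → ℂ) : om (x + x') y = om x y + om x' y := by
  simp [om]; ring
lemma om_sub_left (x x' y : Fin 2 → ℂ) : om (x - x') y = om x y - om x' y := by
  simp [om]; ring
lemma om_self (x : Fin 2 → ℂ) : om x x = 0 := by
  simp [om]; ring
lemma om_zero_left (x : Fin 2 → ℂ) : om 0 x = 0 := by
  simp [om]
lemma om_zero_right (x : Fin 2 → ℂ) : om x 0 = 0 := by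
  simp [om]

section core
variable {W : Type*} [AddCommGroup W] [Module ℂ W] (β : W →ₗ[ℂ] W →ₗ[ℂ] ℂ)

lemma om_swap_span (a b c : W) : Submodule.span ℂ {a, b, c} = Submodule.span ℂ {a, c, b} := by
  rw [Set.pair_comm b c]

lemma span_drop_last (P Q R : W) (h : R ∈ Submodule.span ℂ {Q}) :
    Submodule.span ℂ {P, Q, R} = Submodule.span ℂ {P, Q} := by
  have : Submodule.span ℂ {Q, R} = Submodule.span ℂ {Q} := by
    rw [Set.pair_comm]
    exact Submodule.span_insert_eq_span h
  rw [Submodule.span_insert, this, ← Submodule.span_insert]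

/-- Both second rows proportional to `q`. -/
lemma coreA
    (K L : (Fin 2 → ℂ) →ₗ[ℂ] W) (d : ℂ) (hd : d ≠ 0)
    (hβ : ∀ x y x' y', β (K x + L y) (K x' + L y') = d * (om x y' + om x' y))
    (p1 p2 q : Fin 2 → ℂ) (hq : q ≠ 0) :
    ∃ x, AmpleSub β (Submodule.span ℂ {K p1 + L p2, K x + L q}) := by
  by_cases h : om q p2 = 0
  · obtain ⟨m, rfl⟩ := om_prop q p2 hq h
    by_cases hm : m = 0
    · subst hm
      by_cases h1 : om p1 q = 0
      · refine ⟨0, ampleSub_iso β _ _ ?_ ?_ ?_ ?_⟩ <;>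
          simp only [hβ, zero_smul, om_zero_left, om_zero_right, h1, add_zero, mul_zero]
      · refine ⟨0, ampleSub_two β _ _ ?_⟩
        simp only [hβ, zero_smul, om_zero_left, om_zero_right]
        simp [h1, hd]
    · refine ⟨m⁻¹ • p1, ?_⟩
      rw [Submodule.span_insert_eq_span]
      · exact ampleSub_one β _
      · rw [Submodule.mem_span_singleton]
        refine ⟨m, ?_⟩
        rw [smul_add, ← map_smul, ← map_smul, smul_smul, mul_inv_cancel₀ hm, one_smul]
  · obtain ⟨x, hx1, hx2⟩ := om_solve q p2 h 0 (1 - om p1 q)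
    refine ⟨x, ampleSub_two β _ _ ?_⟩
    simp only [hβ, hx1, hx2]
    simp [hd]

/-- Second rows `q, r` independent, `p2` has nonzero `q`-component. -/
lemma coreB
    (K L : (Fin 2 → ℂ) →ₗ[ℂ] W) (d : ℂ) (hd : d ≠ 0)
    (hβ : ∀ x y x' y', β (K x + L y) (K x' + L y') = d * (om x y' + om x' y))
    (p1 q r : Fin 2 → ℂ) (h : om q r ≠ 0) (a b : ℂ) (ha : a ≠ 0) :
    ∃ x y, AmpleSub β
      (Submodule.span ℂ {K p1 + L (a • q + b • r), K x + L q, K y + L r}) := by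
  obtain ⟨y, hy1, hy2⟩ := om_solve q r h (1 - a⁻¹ * om p1 r) 0
  refine ⟨a⁻¹ • (p1 - b • y), y, ?_⟩
  rw [Submodule.span_insert_eq_span]
  · apply ampleSub_two
    simp only [hβ, om_smul_left, om_sub_left, hy1, hy2]
    simp [hd]
  · rw [Submodule.mem_span_pair]
    refine ⟨a, b, ?_⟩
    simp only [map_add, map_sub, map_smul, smul_add, smul_sub, smul_smul, mul_inv_cancel₀ ha]
    rw [← mul_assoc, mul_inv_cancel₀ ha]
    module

/-- Second rows `q, r` independent, `p2 = 0`, `p1 ∧ q ≠ 0`. -/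
lemma coreC
    (K L : (Fin 2 → ℂ) →ₗ[ℂ] W) (d : ℂ) (hd : d ≠ 0)
    (hβ : ∀ x y x' y', β (K x + L y) (K x' + L y') = d * (om x y' + om x' y))
    (hs : ∀ x y, β x y = β y x) (p1 q r : Fin 2 → ℂ) (h : om q r ≠ 0)
    (h1 : om p1 q ≠ 0) :
    ∃ x y, AmpleSub β (Submodule.span ℂ {K p1 + L 0, K x + L q, K y + L r}) := by
  obtain ⟨y, hy1, hy2⟩ := om_solve q r h 0 1
  refine ⟨0, y, ampleSub_three β hs _ _ _ ?_⟩
  simp only [hβ, om_zero_left, om_zero_right, hy1, hy2]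
  simp [hd, h1]

lemma core
    (K L : (Fin 2 → ℂ) →ₗ[ℂ] W) (d : ℂ) (hd : d ≠ 0)
    (hβ : ∀ x y x' y', β (K x + L y) (K x' + L y') = d * (om x y' + om x' y))
    (hs : ∀ x y, β x y = β y x) (p1 p2 q r : Fin 2 → ℂ) :
    ∃ x y, AmpleSub β (Submodule.span ℂ {K p1 + L p2, K x + L q, K y + L r}) := by
  by_cases h : om q r = 0
  · by_cases hq : q = 0
    · subst hq
      by_cases hr : r = 0
      · subst hr
        refine ⟨0, 0, ?_⟩
        rw [span_drop_last, Set.pair_comm, Submodule.span_insert_eq_span]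
        · exact ampleSub_one β _
        · simp
        · simp
      · obtain ⟨y, hy⟩ := coreA β K L d hd hβ p1 p2 r hr
        refine ⟨0, y, ?_⟩
        rw [om_swap_span, span_drop_last]
        · exact hy
        · simp
    · obtain ⟨m, rfl⟩ := om_prop q r hq h
      obtain ⟨x, hx⟩ := coreA β K L d hd hβ p1 p2 q hq
      refine ⟨x, m • x, ?_⟩
      rw [span_drop_last]
      · exact hx
      · rw [Submodule.mem_span_singleton]
        exact ⟨m, by simp⟩
  · have h' : om r q ≠ 0 := by
      intro h0
      apply h
      simp only [om] at *
      linear_combination -h0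
    obtain ⟨a, b, rfl⟩ := om_span q r p2 h
    by_cases ha : a = 0
    · by_cases hb : b = 0
      · subst ha hb
        rw [zero_smul, zero_smul, add_zero]
        by_cases h1 : om p1 q = 0
        · by_cases h2 : om p1 r = 0
          · have : p1 = 0 := by
              obtain ⟨s, t, rfl⟩ := om_span q r p1 h
              simp only [om_add_left, om_smul_left, om_self] at h1 h2
              simp [h, h'] at h1 h2
              simp [h1, h2]
            subst this
            obtain ⟨y, hy1, hy2⟩ := om_solve q r h 1 0
            refine ⟨0, y, ?_⟩
            rw [map_zero, map_zero, add_zero, Submodule.span_insert_zero, ← map_zero K]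
            apply ampleSub_two
            simp only [hβ, om_zero_left, hy1, hy2]
            simp [hd]
          · obtain ⟨y, x, hh⟩ := coreC β K L d hd hβ hs p1 r q h' h2
            exact ⟨x, y, by rwa [om_swap_span]⟩
        · exact coreC β K L d hd hβ hs p1 q r h h1
      · obtain ⟨y, x, hh⟩ := coreB β K L d hd hβ p1 r q h' b a hb
        rw [add_comm (b • r)] at hh
        exact ⟨x, y, by rwa [om_swap_span]⟩
    · exact coreB β K L d hd hβ p1 q r h a b ha
end core

/-- `x ↦ b xᵀ` as a linear map. -/
def outer (b : Fin 2 → ℂ) : (Fin 2 → ℂ) →ₗ[ℂ] Matrix (Fin 2) (Fin 2) ℂ where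
  toFun := Matrix.vecMulVec b
  map_add' := fun x y => by
    ext i j
    simp [Matrix.vecMulVec_apply, mul_add]
  map_smul' := fun c x => by
    ext i j
    simp [Matrix.vecMulVec_apply]
    ring

lemma outer_surj (b b' : Fin 2 → ℂ) (h : om b b' ≠ 0) (M : Matrix (Fin 2) (Fin 2) ℂ) :
    ∃ x y, M = outer b x + outer b' y := by
  refine ⟨fun j => (om b b')⁻¹ * (b' 1 * M 0 j - b' 0 * M 1 j),
    fun j => (om b b')⁻¹ * (b 0 * M 1 j - b 1 * M 0 j), ?_⟩
  have : om b b' * (om b b')⁻¹ = 1 := mul_inv_cancel₀ h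
  generalize (om b b')⁻¹ = i at *
  simp only [om] at this
  ext k j
  fin_cases k <;> simp [outer, Matrix.vecMulVec_apply]
  · linear_combination -M 0 j * this
  · linear_combination -M 1 j * this

/-- Proposition 5(B): let `β_det` be the polar bilinear form of the determinant on `M₂(ℂ)`.
If `A : ⋀²ℂ³ → M₂(ℂ)` is not ample with respect to `β_det` and `B : ℂ³ → ℂ²` is nonzero,
then there is `C : ℂ³ → ℂ²` such that `A + B∧C` is ample, where `B∧C` is the unique linear
map sending `u ∧ v` to `(B u)·(C v)ᵀ − (B v)·(C u)ᵀ`. -/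
theorem not_ample_perturb_wedge
    (βdet : Matrix (Fin 2) (Fin 2) ℂ →ₗ[ℂ] Matrix (Fin 2) (Fin 2) ℂ →ₗ[ℂ] ℂ)
    (hβdet : ∀ X Y : Matrix (Fin 2) (Fin 2) ℂ, βdet X Y = (X + Y).det - X.det - Y.det)
    (A : ↥(⋀[ℂ]^2 (Fin 3 → ℂ)) →ₗ[ℂ] Matrix (Fin 2) (Fin 2) ℂ)
    (hA : ¬ IsAmple βdet A)
    (B : (Fin 3 → ℂ) →ₗ[ℂ] (Fin 2 → ℂ)) (hB : B ≠ 0) :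
    ∃ C : (Fin 3 → ℂ) →ₗ[ℂ] (Fin 2 → ℂ),
      ∃ D : ↥(⋀[ℂ]^2 (Fin 3 → ℂ)) →ₗ[ℂ] Matrix (Fin 2) (Fin 2) ℂ,
        (∀ u v : Fin 3 → ℂ,
          D (wedge3 u v) = Matrix.vecMulVec (B u) (C v) - Matrix.vecMulVec (B v) (C u)) ∧
        IsAmple βdet (A + D) := by
  have hs : ∀ X Y, βdet X Y = βdet Y X := by
    intro X Y
    rw [hβdet, hβdet, add_comm X Y]
    ring
  have hform : ∀ b b' x y x' y', βdet (outer b x + outer b' y) (outer b x' + outer b' y') =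
      om b b' * (om x y' + om x' y) := by
    intro b b' x y x' y'
    rw [hβdet]
    simp [Matrix.det_fin_two, outer, Matrix.vecMulVec_apply, om]
    ring
  have hn : ∀ X, X ≠ 0 → ∃ Y, βdet X Y ≠ 0 := by
    intro X
    contrapose!
    intro h
    have a1 := h !![1, 0; 0, 0]
    have a2 := h !![0, 1; 0, 0]
    have a3 := h !![0, 0; 1, 0]
    have a4 := h !![0, 0; 0, 1]
    simp only [hβdet, Matrix.det_fin_two] at a1 a2 a3 a4
    simp at a1 a2 a3 a4
    ext i j
    fin_cases i <;> fin_cases j <;> simp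
    · linear_combination a4
    · linear_combination -a3
    · linear_combination -a2
    · linear_combination a1
  obtain ⟨f, hf2, hf⟩ := exists_adapted_basis B hB
  -- reduce to a choice of the values of `C` on the basis
  suffices H : ∃ c : Fin 3 → Fin 2 → ℂ, AmpleSub βdet (Submodule.span ℂ
      {A (wedge3 (f 1) (f 2)) + (outer (B (f 1)) (c 2) - outer (B (f 2)) (c 1)),
       A (wedge3 (f 0) (f 1)) + (outer (B (f 0)) (c 1) - outer (B (f 1)) (c 0)),
       A (wedge3 (f 0) (f 2)) + (outer (B (f 0)) (c 2) - outer (B (f 2)) (c 0))}) by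
    obtain ⟨c, hc⟩ := H
    obtain ⟨D, hD⟩ := exists_wedge_map B (f.constr ℂ c)
    refine ⟨f.constr ℂ c, D, hD, ?_⟩
    change AmpleSub βdet (LinearMap.range (A + D))
    rw [range_eq_span_wedge f]
    simp only [LinearMap.add_apply, hD, Module.Basis.constr_basis]
    exact hc
  have ho : ∀ x, outer 0 x = 0 := by
    intro x
    ext i j
    simp [outer, Matrix.vecMulVec_apply]
  rw [hf2]
  simp only [ho, sub_zero]
  rcases hf with ⟨hb, hf1⟩ | hf
  · rw [hf1]
    simp only [ho, sub_zero, add_zero]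
    obtain ⟨b', hb'⟩ : ∃ b', om (B (f 0)) b' ≠ 0 := by
      by_contra! h
      have h1 := h ![0, 1]
      have h2 := h ![1, 0]
      simp [om] at h1 h2
      apply hb
      ext i
      fin_cases i <;> simp [h1, h2]
    obtain ⟨p1, p2, hP⟩ := outer_surj _ _ hb' (A (wedge3 (f 1) (f 2)))
    obtain ⟨q1, q, hQ⟩ := outer_surj _ _ hb' (A (wedge3 (f 0) (f 1)))
    obtain ⟨r1, r, hR⟩ := outer_surj _ _ hb' (A (wedge3 (f 0) (f 2)))
    obtain ⟨x, y, hxy⟩ := core βdet (outer (B (f 0))) (outer b') _ hb' (hform _ _) hs p1 p2 q r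
    refine ⟨![0, x - q1, y - r1], ?_⟩
    rw [hP, hQ, hR]
    convert hxy using 4
    · simp
      abel
    · congr 1
      simp
      abel
  · obtain ⟨Z, hZ⟩ := exists_ampleSub βdet hs hn (A (wedge3 (f 1) (f 2))) (A (wedge3 (f 0) (f 2)))
    obtain ⟨x, y, hM⟩ := outer_surj _ _ hf (Z - A (wedge3 (f 0) (f 1)))
    refine ⟨![-y, x, 0], ?_⟩
    have hZ' : A (wedge3 (f 0) (f 1)) + (outer (B (f 0)) x - outer (B (f 1)) (-y)) = Z := by
      rw [map_neg, sub_neg_eq_add, ← hM]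
      abel
    simp only [Matrix.cons_val, map_zero, add_zero]
    rw [hZ', Set.insert_comm]
    exact hZ
end

section
/- Let δ = e₁ ∧ e₂ ∧ e₃ ∧ e₄ be the standard generator of ⋀⁴ℂ⁴ and let β_Pf be the symmetric bilinear form on ⋀²ℂ⁴ determined by ω ∧ η = β_Pf(ω, η) • δ. Let β_det(X, Y) = det(X + Y) − det X − det Y on 2 × 2 complex matrices. Call a bilinear map φ : ℂ² × ℂ² → ⋀³ℂ⁴ det-ample if the subspace of M₂(ℂ) consisting of the matrices (ψ(φ(eᵢ, eⱼ)))_{i,j}, as ψ ranges over all linear functionals on ⋀³ℂ⁴, has restriction of β_det either identically zero or nondegenerate. Suppose the linear map A : ℂ² → ⋀²ℂ⁴ is not ample with respect to β_Pf and the bilinear map B : ℂ² × ℂ² → ⋀³ℂ⁴ is not det-ample. Then there exists a linear map C : ℂ² → ℂ⁴ such that the bilinear map (x, y) ↦ B(x, y) + A(x) ∧ C(y) is det-ample. -/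
open ExteriorAlgebra

/-- The standard generator `δ = e₁ ∧ e₂ ∧ e₃ ∧ e₄` of `⋀⁴ℂ⁴`. -/
noncomputable def delta4 : ExteriorAlgebra ℂ (Fin 4 → ℂ) :=
  ι ℂ (Pi.single 0 1) * ι ℂ (Pi.single 1 1) * ι ℂ (Pi.single 2 1) * ι ℂ (Pi.single 3 1)

/-- Given a bilinear map `φ : ℂ² × ℂ² → W`, the linear map sending a functional `ψ` on `W` to
the `2 × 2` matrix `(ψ(φ(eᵢ, eⱼ)))_{i,j}`.  Its range is the subspace of `M₂(ℂ)` of matrices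
obtained as `ψ` ranges over all linear functionals on `W`. -/
def thetaMap {W : Type*} [AddCommGroup W] [Module ℂ W]
    (φ : (Fin 2 → ℂ) →ₗ[ℂ] (Fin 2 → ℂ) →ₗ[ℂ] W) :
    (W →ₗ[ℂ] ℂ) →ₗ[ℂ] Matrix (Fin 2) (Fin 2) ℂ where
  toFun ψ := Matrix.of fun i j => ψ (φ (Pi.single i 1) (Pi.single j 1))
  map_add' ψ₁ ψ₂ := by
    ext i j
    simp [Matrix.add_apply]
  map_smul' c ψ := by
    ext i j
    simp [Matrix.smul_apply]

/-- A bilinear map `φ : ℂ² × ℂ² → ⋀³ℂ⁴` is `det`-ample if the restriction of the polar form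
of the determinant to the subspace `{(ψ(φ(eᵢ, eⱼ)))_{i,j} | ψ a linear functional}` of
`M₂(ℂ)` is either identically zero or nondegenerate. -/
def DetAmple {W : Type*} [AddCommGroup W] [Module ℂ W]
    (βdet : Matrix (Fin 2) (Fin 2) ℂ →ₗ[ℂ] Matrix (Fin 2) (Fin 2) ℂ →ₗ[ℂ] ℂ)
    (φ : (Fin 2 → ℂ) →ₗ[ℂ] (Fin 2 → ℂ) →ₗ[ℂ] W) : Prop :=
  IsAmple βdet (thetaMap φ)

/-- The bilinear map `(x, y) ↦ A x ∧ C y`, with values in the exterior algebra of `ℂ⁴`. -/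
noncomputable def wedgeAC
    (A : (Fin 2 → ℂ) →ₗ[ℂ] ExteriorAlgebra ℂ (Fin 4 → ℂ))
    (C : (Fin 2 → ℂ) →ₗ[ℂ] (Fin 4 → ℂ)) :
    (Fin 2 → ℂ) →ₗ[ℂ] (Fin 2 → ℂ) →ₗ[ℂ] ExteriorAlgebra ℂ (Fin 4 → ℂ) :=
  ((LinearMap.mul ℂ (ExteriorAlgebra ℂ (Fin 4 → ℂ))).comp A).compl₂ ((ι ℂ).comp C)

/-- The `i`-th basis vector inside the exterior algebra. -/
noncomputable def bv (i : Fin 4) : ExteriorAlgebra ℂ (Fin 4 → ℂ) := ι ℂ (Pi.single i 1)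

/-- The coordinate functional on top degree, built from the determinant. -/
noncomputable def topD : ExteriorAlgebra ℂ (Fin 4 → ℂ) →ₗ[ℂ] ℂ :=
  liftAlternating (fun i => if h : i = 4 then
    (Matrix.detRowAlternating (R := ℂ) (n := Fin 4)).domDomCongr (finCongr h.symm) else 0)

lemma topD_apply (a b c d : Fin 4 → ℂ) :
    topD (ι ℂ a * ι ℂ b * (ι ℂ c * ι ℂ d)) = (Matrix.of ![a, b, c, d]).det := by
  have h : ι ℂ a * ι ℂ b * (ι ℂ c * ι ℂ d) = ιMulti ℂ 4 ![a, b, c, d] := by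
    simp [ιMulti_apply, mul_assoc]
  rw [h, topD, liftAlternating_apply_ιMulti]
  simp
  rfl

lemma topD_delta : topD delta4 = 1 := by
  rw [delta4, mul_assoc, topD_apply]
  simp [Matrix.det_succ_row_zero, Fin.sum_univ_succ, Pi.single_apply, Fin.succAbove]

/-- The bivector with given Pluecker coordinates. -/
noncomputable def biv (p : Fin 6 → ℂ) : ExteriorAlgebra ℂ (Fin 4 → ℂ) :=
  p 0 • (bv 0 * bv 1) + p 1 • (bv 0 * bv 2) + p 2 • (bv 0 * bv 3) +
  p 3 • (bv 1 * bv 2) + p 4 • (bv 1 * bv 3) + p 5 • (bv 2 * bv 3)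

lemma bv_sq (i : Fin 4) : bv i * bv i = 0 := ι_sq_zero _

lemma bv_swap (i j : Fin 4) : bv i * bv j = - (bv j * bv i) :=
  eq_neg_of_add_eq_zero_left (ι_add_mul_swap _ _)

lemma ι_eq (a : Fin 4 → ℂ) : ι ℂ a = a 0 • bv 0 + a 1 • bv 1 + a 2 • bv 2 + a 3 • bv 3 := by
  have h : a = a 0 • Pi.single 0 1 + a 1 • Pi.single 1 1 + a 2 • Pi.single 2 1
      + a 3 • (Pi.single 3 1 : Fin 4 → ℂ) := by
    ext i; fin_cases i <;> simp
  conv_lhs => rw [h]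
  simp [bv]

lemma biv_add (p q : Fin 6 → ℂ) : biv (p + q) = biv p + biv q := by
  simp only [biv, Pi.add_apply]; module

lemma biv_smul (t : ℂ) (q : Fin 6 → ℂ) : biv (t • q) = t • biv q := by
  simp only [biv, Pi.smul_apply, smul_eq_mul]; module

lemma exists_biv (w : ExteriorAlgebra ℂ (Fin 4 → ℂ)) (hw : w ∈ ⋀[ℂ]^2 (Fin 4 → ℂ)) :
    ∃ p, w = biv p := by
  rw [← exteriorPower.ιMulti_span_fixedDegree] at hw
  induction hw using Submodule.span_induction with
  | mem x hx =>
    obtain ⟨v, rfl⟩ := hx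
    refine ⟨![v 0 0 * v 1 1 - v 0 1 * v 1 0, v 0 0 * v 1 2 - v 0 2 * v 1 0,
      v 0 0 * v 1 3 - v 0 3 * v 1 0, v 0 1 * v 1 2 - v 0 2 * v 1 1,
      v 0 1 * v 1 3 - v 0 3 * v 1 1, v 0 2 * v 1 3 - v 0 3 * v 1 2], ?_⟩
    have h : ιMulti ℂ 2 v = ι ℂ (v 0) * ι ℂ (v 1) := by
      simp [ιMulti_apply, Matrix.vecTail]
    rw [h, ι_eq, ι_eq (v 1)]
    simp only [mul_add, add_mul, smul_mul_smul_comm, bv_sq, smul_zero]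
    rw [bv_swap 1 0, bv_swap 2 0, bv_swap 3 0, bv_swap 2 1, bv_swap 3 1, bv_swap 3 2]
    simp [biv]
    module
  | zero => exact ⟨0, by simp [biv]⟩
  | add x y _ _ hx hy =>
    obtain ⟨p, rfl⟩ := hx
    obtain ⟨q, rfl⟩ := hy
    exact ⟨p + q, (biv_add p q).symm⟩
  | smul t x _ hx =>
    obtain ⟨p, rfl⟩ := hx
    exact ⟨t • p, (biv_smul t p).symm⟩

lemma topD_biv_ι (p : Fin 6 → ℂ) (c e : Fin 4 → ℂ) :
    topD (biv p * (ι ℂ c * ι ℂ e)) =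
      p 0 * (c 2 * e 3 - c 3 * e 2) - p 1 * (c 1 * e 3 - c 3 * e 1)
      + p 2 * (c 1 * e 2 - c 2 * e 1) + p 3 * (c 0 * e 3 - c 3 * e 0)
      - p 4 * (c 0 * e 2 - c 2 * e 0) + p 5 * (c 0 * e 1 - c 1 * e 0) := by
  simp only [biv, bv, add_mul, smul_mul_assoc, map_add, map_smul, topD_apply, smul_eq_mul]
  simp [Matrix.det_succ_row_zero, Fin.sum_univ_succ, Pi.single_apply, Fin.succAbove]
  ring

lemma topD_biv_biv (p q : Fin 6 → ℂ) :
    topD (biv p * biv q) =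
      p 0 * q 5 - p 1 * q 4 + p 2 * q 3 + p 3 * q 2 - p 4 * q 1 + p 5 * q 0 := by
  conv_lhs => rw [biv.eq_1 q]
  simp only [bv, mul_add, mul_smul_comm, map_add, map_smul, topD_biv_ι, smul_eq_mul]
  simp [Pi.single_apply]
  ring

/-- The components of `biv p ∧ c`. -/
def comp3 (p : Fin 6 → ℂ) (c : Fin 4 → ℂ) : Fin 4 → ℂ :=
  ![-p 3 * c 3 + p 4 * c 2 - p 5 * c 1, p 1 * c 3 - p 2 * c 2 + p 5 * c 0,
    -p 0 * c 3 + p 2 * c 1 - p 4 * c 0, p 0 * c 2 - p 1 * c 1 + p 3 * c 0]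

lemma topD_comp3 (p : Fin 6 → ℂ) (c : Fin 4 → ℂ) (k : Fin 4) :
    topD (biv p * ι ℂ c * bv k) = comp3 p c k := by
  rw [mul_assoc, bv, topD_biv_ι]
  fin_cases k <;> simp [comp3, Pi.single_apply] <;> ring

/-- The polarized Pfaffian in coordinates. -/
def pol (p q : Fin 6 → ℂ) : ℂ :=
  p 0 * q 5 - p 1 * q 4 + p 2 * q 3 + p 3 * q 2 - p 4 * q 1 + p 5 * q 0

/-- The dual coordinates. -/
def hatv (p : Fin 6 → ℂ) : Fin 6 → ℂ := ![p 5, -p 4, p 3, p 2, -p 1, p 0]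

lemma hat_identity (p q : Fin 6 → ℂ) (c : Fin 4 → ℂ) :
    comp3 (hatv q) (comp3 p c) + comp3 (hatv p) (comp3 q c) = -pol p q • c := by
  ext k
  fin_cases k <;> simp [comp3, hatv, pol] <;> ring

lemma hat_identity' (p : Fin 6 → ℂ) (c : Fin 4 → ℂ) :
    (2 : ℂ) • comp3 p (comp3 (hatv p) c) = -pol p p • c := by
  ext k
  fin_cases k <;> simp [comp3, hatv, pol] <;> ring

lemma comp3_add (p : Fin 6 → ℂ) (c d : Fin 4 → ℂ) :
    comp3 p (c + d) = comp3 p c + comp3 p d := by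
  ext k
  fin_cases k <;> simp [comp3] <;> ring

lemma comp3_smul (p : Fin 6 → ℂ) (t : ℂ) (c : Fin 4 → ℂ) :
    comp3 p (t • c) = t • comp3 p c := by
  ext k
  fin_cases k <;> simp [comp3] <;> ring

lemma comp3_add' (p q : Fin 6 → ℂ) (c : Fin 4 → ℂ) :
    comp3 (p + q) c = comp3 p c + comp3 q c := by
  ext k
  fin_cases k <;> simp [comp3] <;> ring

lemma comp3_smul' (p : Fin 6 → ℂ) (t : ℂ) (c : Fin 4 → ℂ) :
    comp3 (t • p) c = t • comp3 p c := by
  ext k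
  fin_cases k <;> simp [comp3] <;> ring

lemma comp3_zero (p : Fin 6 → ℂ) : comp3 p 0 = 0 := by
  simpa using comp3_smul p 0 0

lemma core1 (p : Fin 6 → ℂ) (hp : pol p p ≠ 0) (c : Fin 4 → ℂ) (h : comp3 p c = 0) : c = 0 := by
  have := hat_identity p p c
  rw [h, comp3_zero, add_zero] at this
  simpa [hp] using this.symm

lemma core2 (p q : Fin 6 → ℂ) (hp : pol p p ≠ 0) (hq : pol q q = 0) (hpq : pol p q = 0)
    (c d : Fin 4 → ℂ) (h : comp3 p c + comp3 q d = 0) : comp3 q c = 0 := by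
  have h1 : comp3 (hatv q) (comp3 q d) = 0 := by
    have := hat_identity q q d
    rw [hq, ← two_smul ℂ] at this
    simpa using this
  have h2 : comp3 (hatv q) (comp3 p c) = 0 := by
    have := comp3_add (hatv q) (comp3 p c) (comp3 q d)
    rw [h, h1, comp3_zero, add_zero] at this
    exact this.symm
  have h3 := hat_identity p q c
  rw [h2, hpq, zero_add, neg_zero, zero_smul] at h3
  have h4 := hat_identity' p (comp3 q c)
  rw [h3, comp3_zero, smul_zero] at h4
  simpa [hp] using h4.symm

lemma exists_uv (q : Fin 6 → ℂ) (hq : q ≠ 0) : ∃ u v : Fin 4 → ℂ, ∀ a b : ℂ,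
    comp3 q (a • u + b • v) = 0 → a = 0 ∧ b = 0 := by
  obtain ⟨i, hi⟩ := Function.ne_iff.mp hq
  have key : ∃ k l : Fin 4, ∀ a b : ℂ,
      comp3 q (a • Pi.single k 1 + b • Pi.single l 1) = 0 → a = 0 ∧ b = 0 := by
    fin_cases i
    · refine ⟨2, 3, fun a b h => ?_⟩
      have h0 := congrFun h 2
      have h1 := congrFun h 3
      simp [comp3] at h0 h1 hi
      tauto
    · refine ⟨1, 3, fun a b h => ?_⟩
      have h0 := congrFun h 1
      have h1 := congrFun h 3
      simp [comp3] at h0 h1 hi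
      tauto
    · refine ⟨1, 2, fun a b h => ?_⟩
      have h0 := congrFun h 1
      have h1 := congrFun h 2
      simp [comp3] at h0 h1 hi
      tauto
    · refine ⟨0, 3, fun a b h => ?_⟩
      have h0 := congrFun h 0
      have h1 := congrFun h 3
      simp [comp3] at h0 h1 hi
      tauto
    · refine ⟨0, 2, fun a b h => ?_⟩
      have h0 := congrFun h 0
      have h1 := congrFun h 2
      simp [comp3] at h0 h1 hi
      tauto
    · refine ⟨0, 1, fun a b h => ?_⟩
      have h0 := congrFun h 0
      have h1 := congrFun h 1
      simp [comp3] at h0 h1 hi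
      tauto
  obtain ⟨k, l, h⟩ := key
  exact ⟨_, _, h⟩

lemma pol_comm (p q : Fin 6 → ℂ) : pol p q = pol q p := by
  simp only [pol]; ring

lemma pol_lin (r p q : Fin 6 → ℂ) (x y : ℂ) :
    pol r (x • p + y • q) = x * pol r p + y * pol r q := by
  simp [pol]; ring

/-- Independence when the degenerate direction has nonzero second coordinate. -/
lemma indep_aux (r s : Fin 6 → ℂ) (x y : ℂ) (hy : y ≠ 0) (hq : x • r + y • s ≠ 0)
    (hr : pol r (x • r + y • s) = 0) (hs : pol s (x • r + y • s) = 0)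
    (hne : ¬ (pol r r = 0 ∧ pol r s = 0 ∧ pol s s = 0)) :
    ∃ u v : Fin 4 → ℂ, ∀ a b a' b' : ℂ,
      comp3 r (a • u + b • v) + comp3 s (a' • u + b' • v) = 0 →
      a = 0 ∧ b = 0 ∧ a' = 0 ∧ b' = 0 := by
  have hrr : pol r r ≠ 0 := by
    intro h0
    rw [pol_lin] at hr hs
    have h1 : pol r s = 0 := by simpa [h0, hy] using hr
    have h2 : pol s s = 0 := by simpa [pol_comm s r, h1, hy] using hs
    exact hne ⟨h0, h1, h2⟩
  have hqq : pol (x • r + y • s) (x • r + y • s) = 0 := by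
    rw [pol_lin, pol_comm _ r, pol_comm _ s, hr, hs]; simp
  obtain ⟨u, v, huv⟩ := exists_uv _ hq
  refine ⟨u, v, fun a b a' b' h => ?_⟩
  have e : comp3 r ((a - x / y * a') • u + (b - x / y * b') • v) +
      comp3 (x • r + y • s) ((a' / y) • u + (b' / y) • v) = 0 := by
    rw [← h]
    simp only [comp3_add, comp3_smul, comp3_add', comp3_smul']
    ext k
    simp
    field_simp
    ring
  obtain ⟨h1, h2⟩ := huv _ _ (core2 _ _ hrr hqq hr _ _ e)
  rw [h1, h2] at e
  simp only [zero_smul, add_zero, comp3_zero, zero_add] at e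
  obtain ⟨h3, h4⟩ := huv _ _ e
  have h5 : a' = 0 := by simpa [hy] using h3
  have h6 : b' = 0 := by simpa [hy] using h4
  subst h5 h6
  simp at h1 h2
  exact ⟨h1, h2, rfl, rfl⟩

lemma indep (r s : Fin 6 → ℂ) (x y : ℂ) (hq : x • r + y • s ≠ 0)
    (hr : pol r (x • r + y • s) = 0) (hs : pol s (x • r + y • s) = 0)
    (hne : ¬ (pol r r = 0 ∧ pol r s = 0 ∧ pol s s = 0)) :
    ∃ u v : Fin 4 → ℂ, ∀ a b a' b' : ℂ,
      comp3 r (a • u + b • v) + comp3 s (a' • u + b' • v) = 0 →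
      a = 0 ∧ b = 0 ∧ a' = 0 ∧ b' = 0 := by
  by_cases hy : y = 0
  · have hx : x ≠ 0 := by
      rintro rfl
      simp [hy] at hq
    rw [add_comm (x • r)] at hq hr hs
    obtain ⟨u, v, h⟩ := indep_aux s r y x hx hq hs hr (by rw [pol_comm s r]; tauto)
    refine ⟨u, v, fun a b a' b' h' => ?_⟩
    have := h a' b' a b (by rw [add_comm]; exact h')
    tauto
  · exact indep_aux r s x y hy hq hr hs hne

lemma exists_det (M N : Matrix (Fin 4) (Fin 4) ℂ) (hM : M.det ≠ 0) :
    ∃ t : ℂ, (N + t • M).det ≠ 0 := by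
  have hu : IsUnit M.det := isUnit_iff_ne_zero.mpr hM
  have hne : (-(N * M⁻¹)).charpoly ≠ 0 := (Matrix.charpoly_monic _).ne_zero
  obtain ⟨t, ht⟩ : ∃ t, (-(N * M⁻¹)).charpoly.eval t ≠ 0 := by
    by_contra! h
    exact hne (Polynomial.funext (by simpa using h))
  refine ⟨t, ?_⟩
  rw [Matrix.eval_charpoly] at ht
  have : N + t • M = (Matrix.scalar (Fin 4) t - -(N * M⁻¹)) * M := by
    rw [sub_neg_eq_add, add_mul, Matrix.nonsing_inv_mul_cancel_right _ _ hu, add_comm]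
    congr 1
    ext i j
    simp
  rw [this, Matrix.det_mul]
  exact mul_ne_zero ht hM

lemma surj_of_det {W : Type*} [AddCommGroup W] [Module ℂ W]
    (φ : (Fin 2 → ℂ) →ₗ[ℂ] (Fin 2 → ℂ) →ₗ[ℂ] W) (ψ : Fin 4 → W →ₗ[ℂ] ℂ)
    (h : (Matrix.of fun k l : Fin 4 => ψ k (![φ (Pi.single 0 1) (Pi.single 0 1),
      φ (Pi.single 0 1) (Pi.single 1 1), φ (Pi.single 1 1) (Pi.single 0 1),
      φ (Pi.single 1 1) (Pi.single 1 1)] l)).det ≠ 0) :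
    Function.Surjective (thetaMap φ) := by
  intro X
  set T := (Matrix.of fun k l : Fin 4 => ψ k (![φ (Pi.single 0 1) (Pi.single 0 1),
      φ (Pi.single 0 1) (Pi.single 1 1), φ (Pi.single 1 1) (Pi.single 0 1),
      φ (Pi.single 1 1) (Pi.single 1 1)] l)) with hT
  let s := Matrix.vecMul ![X 0 0, X 0 1, X 1 0, X 1 1] T⁻¹
  have hs : Matrix.vecMul s T = ![X 0 0, X 0 1, X 1 0, X 1 1] := by
    simp only [s, Matrix.vecMul_vecMul]
    rw [Matrix.nonsing_inv_mul _ (isUnit_iff_ne_zero.mpr h), Matrix.vecMul_one]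
  refine ⟨∑ k, s k • ψ k, ?_⟩
  have e (l : Fin 4) := congrFun hs l
  have e0 := e 0
  have e1 := e 1
  have e2 := e 2
  have e3 := e 3
  simp [Matrix.vecMul, dotProduct, hT] at e0 e1 e2 e3
  ext i j
  change (∑ k, s k • ψ k) (φ (Pi.single i 1) (Pi.single j 1)) = X i j
  simp only [LinearMap.sum_apply, LinearMap.smul_apply, smul_eq_mul]
  fin_cases i <;> fin_cases j <;> assumption

lemma ample_of_surj
    (βdet : Matrix (Fin 2) (Fin 2) ℂ →ₗ[ℂ] Matrix (Fin 2) (Fin 2) ℂ →ₗ[ℂ] ℂ)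
    (hβdet : ∀ X Y : Matrix (Fin 2) (Fin 2) ℂ, βdet X Y = (X + Y).det - X.det - Y.det)
    {E : Type*} [AddCommGroup E] [Module ℂ E] (f : E →ₗ[ℂ] Matrix (Fin 2) (Fin 2) ℂ)
    (hf : Function.Surjective f) : IsAmple βdet f := by
  right
  intro w _ hw
  by_contra! h
  apply hw
  have h' (Y : Matrix (Fin 2) (Fin 2) ℂ) : (w + Y).det - w.det - Y.det = 0 := by
    rw [← hβdet]
    exact h Y (hf Y)
  have a0 := h' !![1, 0; 0, 0]
  have a1 := h' !![0, 1; 0, 0]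
  have a2 := h' !![0, 0; 1, 0]
  have a3 := h' !![0, 0; 0, 1]
  simp [Matrix.det_fin_two] at a0 a1 a2 a3
  ext i j
  fin_cases i <;> fin_cases j <;> simp <;> grind

/-- Proposition 6(A): let `β_Pf` be the bilinear form on `⋀²ℂ⁴` determined by
`ω ∧ η = β_Pf(ω, η) • δ` and let `β_det` be the polar form of the determinant on `M₂(ℂ)`.
If `A : ℂ² → ⋀²ℂ⁴` is not ample with respect to `β_Pf` and the bilinear map
`B : ℂ² × ℂ² → ⋀³ℂ⁴` is not `det`-ample, then `(x, y) ↦ B(x, y) + A x ∧ C y` is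
`det`-ample for some `C : ℂ² → ℂ⁴`. -/
theorem not_detAmple_perturb_wedge
    (βdet : Matrix (Fin 2) (Fin 2) ℂ →ₗ[ℂ] Matrix (Fin 2) (Fin 2) ℂ →ₗ[ℂ] ℂ)
    (hβdet : ∀ X Y : Matrix (Fin 2) (Fin 2) ℂ, βdet X Y = (X + Y).det - X.det - Y.det)
    (βPf : ExteriorAlgebra ℂ (Fin 4 → ℂ) →ₗ[ℂ] ExteriorAlgebra ℂ (Fin 4 → ℂ) →ₗ[ℂ] ℂ)
    (hβPf : ∀ ω η : ExteriorAlgebra ℂ (Fin 4 → ℂ),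
      ω ∈ ⋀[ℂ]^2 (Fin 4 → ℂ) → η ∈ ⋀[ℂ]^2 (Fin 4 → ℂ) → ω * η = βPf ω η • delta4)
    (A : (Fin 2 → ℂ) →ₗ[ℂ] ExteriorAlgebra ℂ (Fin 4 → ℂ))
    (hA2 : ∀ x, A x ∈ ⋀[ℂ]^2 (Fin 4 → ℂ))
    (hA : ¬ IsAmple βPf A)
    (B : (Fin 2 → ℂ) →ₗ[ℂ] (Fin 2 → ℂ) →ₗ[ℂ] ExteriorAlgebra ℂ (Fin 4 → ℂ))
    (hB3 : ∀ x y, B x y ∈ ⋀[ℂ]^3 (Fin 4 → ℂ))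
    (hB : ¬ DetAmple βdet B) :
    ∃ C : (Fin 2 → ℂ) →ₗ[ℂ] (Fin 4 → ℂ), DetAmple βdet (B + wedgeAC A C) := by
  have hβ (p q : Fin 6 → ℂ) (hp : biv p ∈ ⋀[ℂ]^2 (Fin 4 → ℂ))
      (hq : biv q ∈ ⋀[ℂ]^2 (Fin 4 → ℂ)) : βPf (biv p) (biv q) = pol p q := by
    have := congrArg topD (hβPf _ _ hp hq)
    rw [map_smul, topD_delta, topD_biv_biv] at this
    simpa [pol] using this.symm
  have hdecomp (x : Fin 2 → ℂ) : A x = x 0 • A (Pi.single 0 1) + x 1 • A (Pi.single 1 1) := by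
    rw [← map_smul, ← map_smul, ← map_add]
    congr 1
    ext i; fin_cases i <;> simp
  obtain ⟨r, hr⟩ := exists_biv _ (hA2 (Pi.single 0 1))
  obtain ⟨s, hs⟩ := exists_biv _ (hA2 (Pi.single 1 1))
  have hAx (x : Fin 2 → ℂ) : A x = biv (x 0 • r + x 1 • s) := by
    rw [hdecomp, hr, hs, biv_add, biv_smul, biv_smul]
  have hmem (x : Fin 2 → ℂ) : biv (x 0 • r + x 1 • s) ∈ ⋀[ℂ]^2 (Fin 4 → ℂ) := by
    rw [← hAx]; exact hA2 x
  have hrm : biv r ∈ ⋀[ℂ]^2 (Fin 4 → ℂ) := hr ▸ hA2 _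
  have hsm : biv s ∈ ⋀[ℂ]^2 (Fin 4 → ℂ) := hs ▸ hA2 _
  unfold IsAmple at hA
  push Not at hA
  obtain ⟨⟨_, ⟨x, rfl⟩, _, ⟨y, rfl⟩, hxy⟩, _, ⟨z, rfl⟩, hz, hz0⟩ := hA
  have hz1 := hz0 _ ⟨Pi.single 0 1, rfl⟩
  have hz2 := hz0 _ ⟨Pi.single 1 1, rfl⟩
  rw [hr, hAx, hβ _ _ (hmem z) hrm, pol_comm] at hz1
  rw [hs, hAx, hβ _ _ (hmem z) hsm, pol_comm] at hz2
  obtain ⟨u, v, huv⟩ := indep r s (z 0) (z 1)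
    (by
      intro h0
      apply hz
      rw [hAx, h0]
      simp [biv]) hz1 hz2
    (by
      rintro ⟨h1, h2, h3⟩
      apply hxy
      rw [hAx, hAx, hβ _ _ (hmem x) (hmem y), pol_lin, pol_comm _ r, pol_comm _ s, pol_lin,
        pol_lin, pol_comm s r, h1, h2, h3]
      simp)
  let ψ : Fin 4 → ExteriorAlgebra ℂ (Fin 4 → ℂ) →ₗ[ℂ] ℂ := fun k =>
    topD.comp ((LinearMap.mul ℂ (ExteriorAlgebra ℂ (Fin 4 → ℂ))).flip (bv k))
  have hψ (k : Fin 4) (p : Fin 6 → ℂ) (c : Fin 4 → ℂ) : ψ k (biv p * ι ℂ c) = comp3 p c k := by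
    simp [ψ, topD_comp3]
  let M : Matrix (Fin 4) (Fin 4) ℂ :=
    Matrix.of fun k l => ![comp3 r u k, comp3 r v k, comp3 s u k, comp3 s v k] l
  let N : Matrix (Fin 4) (Fin 4) ℂ :=
    Matrix.of fun k l => ψ k (![B (Pi.single 0 1) (Pi.single 0 1),
      B (Pi.single 0 1) (Pi.single 1 1), B (Pi.single 1 1) (Pi.single 0 1),
      B (Pi.single 1 1) (Pi.single 1 1)] l)
  have hM : M.det ≠ 0 := by
    intro h0
    obtain ⟨w, hw, hMw⟩ := Matrix.exists_mulVec_eq_zero_iff.mpr h0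
    apply hw
    have := huv (w 0) (w 1) (w 2) (w 3) (by
      simp only [comp3_add, comp3_smul]
      rw [← hMw]
      ext k
      simp [M, Matrix.mulVec, dotProduct, Fin.sum_univ_four]
      ring)
    obtain ⟨e0, e1, e2, e3⟩ := this
    ext i; fin_cases i <;> assumption
  obtain ⟨t, ht⟩ := exists_det M N hM
  refine ⟨t • ((LinearMap.proj 0).smulRight u + (LinearMap.proj 1).smulRight v), ?_⟩
  apply ample_of_surj βdet hβdet
  apply surj_of_det _ ψ
  convert ht using 2
  ext k l
  fin_cases l <;> simp [M, N, wedgeAC, hr, hs, hψ]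
end

section
/- Let δ = e₁ ∧ e₂ ∧ e₃ ∧ e₄ be the standard generator of ⋀⁴ℂ⁴ and let β_Pf be the symmetric bilinear form on ⋀²ℂ⁴ determined by ω ∧ η = β_Pf(ω, η) • δ. Suppose the linear map A : ℂ⁴ → ⋀²ℂ⁴ is not ample with respect to β_Pf and u ∈ ℂ⁴ is nonzero. Then there exists a linear map C : ℂ⁴ → ℂ⁴ such that the linear map x ↦ A(x) + C(x) ∧ u is ample with respect to β_Pf. -/
open ExteriorAlgebra

theorem delta4_ne_zero : delta4 ≠ 0 := by
  intro h
  have h2 := congrArg (liftAlternating (R := ℂ) (M := Fin 4 → ℂ) (N := ℂ)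
    (Function.update (fun _ => 0) 4 (Matrix.detRowAlternating (R := ℂ) (n := Fin 4)))) h
  have e : delta4 = ιMulti ℂ 4 (fun i : Fin 4 => (Pi.single i 1 : Fin 4 → ℂ)) := by
    rw [ιMulti_apply]
    simp [delta4, List.ofFn_succ, mul_assoc]
  rw [e, liftAlternating_apply_ιMulti, map_zero, Function.update_self] at h2
  have h3 : (Matrix.of (fun i : Fin 4 => (Pi.single i 1 : Fin 4 → ℂ))) = 1 := by
    ext i j
    simp [Matrix.one_apply, Pi.single_apply, eq_comm]
  have h4 : Matrix.det (Matrix.of (fun i : Fin 4 => (Pi.single i 1 : Fin 4 → ℂ))) = 0 := h2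
  rw [h3, Matrix.det_one] at h4
  exact one_ne_zero h4

theorem map_delta4_eq_zero (f : (Fin 4 → ℂ) →ₗ[ℂ] (Fin 4 → ℂ)) (u : Fin 4 → ℂ) (hu : u ≠ 0)
    (hf : f u = 0) : ExteriorAlgebra.map f delta4 = 0 := by
  have e : ExteriorAlgebra.map f delta4
      = ιMulti ℂ 4 (fun i : Fin 4 => f (Pi.single i 1 : Fin 4 → ℂ)) := by
    rw [ιMulti_apply]
    simp [delta4, List.ofFn_succ, mul_assoc]
  rw [e]
  apply AlternatingMap.map_linearDependent
  intro hli
  apply hu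
  rw [Fintype.linearIndependent_iff] at hli
  funext i
  refine hli u ?_ i
  rw [← hf]
  conv_rhs => rw [pi_eq_sum_univ' u]
  simp

theorem contract_two (φ : Module.Dual ℂ (Fin 4 → ℂ)) (u : Fin 4 → ℂ)
    (ω : ExteriorAlgebra ℂ (Fin 4 → ℂ)) (hω : ω ∈ ⋀[ℂ]^2 (Fin 4 → ℂ)) :
    ω + ι ℂ (ιInv (CliffordAlgebra.contractLeft (Q := (0 : QuadraticForm ℂ (Fin 4 → ℂ))) φ ω))
        * ι ℂ u
      = ExteriorAlgebra.map (LinearMap.id - φ.smulRight u) ω := by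
  have hω' : ω ∈ LinearMap.range (ι ℂ : (Fin 4 → ℂ) →ₗ[ℂ] _) *
      LinearMap.range (ι ℂ : (Fin 4 → ℂ) →ₗ[ℂ] _) := by
    rw [← pow_two]; exact hω
  clear hω
  induction hω' using Submodule.mul_induction_on' with
  | mem_mul_mem m hm n hn =>
    obtain ⟨a, rfl⟩ := hm
    obtain ⟨b, rfl⟩ := hn
    have h : CliffordAlgebra.contractLeft (Q := (0 : QuadraticForm ℂ (Fin 4 → ℂ))) φ
        (ι ℂ a * ι ℂ b) = ι ℂ (φ a • b - φ b • a) := by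
      have := CliffordAlgebra.contractLeft_ι_mul (Q := (0 : QuadraticForm ℂ (Fin 4 → ℂ)))
        (d := φ) a (CliffordAlgebra.ι 0 b)
      rw [CliffordAlgebra.contractLeft_ι] at this
      refine this.trans ?_
      rw [← Algebra.commutes, ← Algebra.smul_def, map_sub, map_smul, map_smul]
    rw [h, ι_leftInverse (R := ℂ) (M := Fin 4 → ℂ) (φ a • b - φ b • a)]
    have hub : ι ℂ u * ι ℂ b = - (ι ℂ b * ι ℂ u) := by
      rw [eq_neg_iff_add_eq_zero]
      exact ι_add_mul_swap u b
    simp only [map_mul, map_apply_ι, LinearMap.sub_apply, LinearMap.id_apply,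
      LinearMap.smulRight_apply, map_sub, map_smul, sub_mul, mul_sub, smul_mul_assoc,
      mul_smul_comm, hub, ι_sq_zero, smul_zero, smul_neg]
    module
  | add x hx y hy ihx ihy =>
    rw [map_add, map_add, map_add, map_add, add_mul, ← ihx, ← ihy]
    module

/-- Proposition 6(E): let `β_Pf` be the bilinear form on `⋀²ℂ⁴` determined by
`ω ∧ η = β_Pf(ω, η) • δ`. If `A : ℂ⁴ → ⋀²ℂ⁴` is not ample with respect to `β_Pf` and
`u ∈ ℂ⁴` is nonzero, then `x ↦ A x + C x ∧ u` is ample for some `C : ℂ⁴ → ℂ⁴`. -/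
theorem not_ample_perturb_wedge_right
    (βPf : ExteriorAlgebra ℂ (Fin 4 → ℂ) →ₗ[ℂ] ExteriorAlgebra ℂ (Fin 4 → ℂ) →ₗ[ℂ] ℂ)
    (hβPf : ∀ ω η : ExteriorAlgebra ℂ (Fin 4 → ℂ),
      ω ∈ ⋀[ℂ]^2 (Fin 4 → ℂ) → η ∈ ⋀[ℂ]^2 (Fin 4 → ℂ) → ω * η = βPf ω η • delta4)
    (A : (Fin 4 → ℂ) →ₗ[ℂ] ExteriorAlgebra ℂ (Fin 4 → ℂ))
    (hA2 : ∀ x, A x ∈ ⋀[ℂ]^2 (Fin 4 → ℂ))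
    (hA : ¬ IsAmple βPf A)
    (u : Fin 4 → ℂ) (hu : u ≠ 0) :
    ∃ C : (Fin 4 → ℂ) →ₗ[ℂ] (Fin 4 → ℂ),
      IsAmple βPf (A + (LinearMap.mulRight ℂ (ι ℂ u)) ∘ₗ ((ι ℂ) ∘ₗ C)) := by
  obtain ⟨i, hi⟩ := Function.ne_iff.mp hu
  have hi : u i ≠ 0 := hi
  let φ : Module.Dual ℂ (Fin 4 → ℂ) := (u i)⁻¹ • LinearMap.proj i
  have hφ : φ u = 1 := by simp [φ, hi]
  have hf : (LinearMap.id - φ.smulRight u : (Fin 4 → ℂ) →ₗ[ℂ] (Fin 4 → ℂ)) u = 0 := by simp [hφ]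
  refine ⟨ιInv ∘ₗ
    (CliffordAlgebra.contractLeft (Q := (0 : QuadraticForm ℂ (Fin 4 → ℂ))) φ) ∘ₗ A, Or.inl ?_⟩
  have key := fun x => contract_two φ u (A x) (hA2 x)
  have mem : ∀ x, ExteriorAlgebra.map (LinearMap.id - φ.smulRight u) (A x)
      ∈ ⋀[ℂ]^2 (Fin 4 → ℂ) := by
    intro x
    rw [← key x]
    refine Submodule.add_mem _ (hA2 x) ?_
    change _ ∈ LinearMap.range (ι ℂ : (Fin 4 → ℂ) →ₗ[ℂ] _) ^ 2
    rw [pow_two]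
    exact Submodule.mul_mem_mul ⟨_, rfl⟩ ⟨_, rfl⟩
  rintro _ ⟨x, rfl⟩ _ ⟨y, rfl⟩
  change βPf (A x + ι ℂ (ιInv (CliffordAlgebra.contractLeft φ (A x))) * ι ℂ u)
    (A y + ι ℂ (ιInv (CliffordAlgebra.contractLeft φ (A y))) * ι ℂ u) = 0
  rw [key x, key y]
  have h := hβPf _ _ (mem x) (mem y)
  rw [← map_mul, hβPf _ _ (hA2 x) (hA2 y), map_smul, map_delta4_eq_zero _ u hu hf,
    smul_zero] at h
  exact (smul_eq_zero.mp h.symm).resolve_right delta4_ne_zero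
end
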